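/- Let F : C ⇄ D : G be a Quillen adjunction, let x be a cofibrant object of C, and let y be a fibrant object of D. Then the inclusion of the full subcategory Fun_{**}(3̃,(C^c+D^f))^W ↪ Fun_{**}(3,(C^c+D^f))^W induces a weak homotopy equivalence of nerves N(Fun_{**}(3̃,(C^c+D^f))^W) → N(Fun_{**}(3,(C^c+D^f))^W). -/

import Mathlib

open CategoryTheory CategoryTheory.Limits Simplicial

universe w v u

namespace Paper

/-- The map constant at vertex `i` of `Δ[1]`. -/
def constVertex (X : SSet.{w}) (i : Fin 2) : X ⟶ Δ[1] where
  app m := ↾fun _ => ULift.up (SimplexCategory.const m.unop ⦋1⦌ i)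
  naturality _ _ _ := by ext _; rfl

/-- Elementary simplicial homotopy between two maps of simplicial sets,
given by a map out of the cylinder `X ⨯ Δ[1]`. -/
def SHomotopy {X Y : SSet.{w}} (f g : X ⟶ Y) : Prop :=
  ∃ H : X ⨯ Δ[1] ⟶ Y,
    prod.lift (𝟙 X) (constVertex X 0) ≫ H = f ∧
    prod.lift (𝟙 X) (constVertex X 1) ≫ H = g

/-- The relation of being simplicially homotopic: the equivalence relation
generated by elementary simplicial homotopies. -/
def Htpy {X Y : SSet.{w}} (f g : X ⟶ Y) : Prop := Relation.EqvGen SHomotopy f g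

/-- A simplicial set `S` is a *Kan complex* if it satisfies the following horn-filling condition:
for every `n : ℕ` and `0 ≤ i ≤ n`,
every map of simplicial sets `σ₀ : Λ[n, i] → S` can be extended to a map `σ : Δ[n] → S`. -/
class KanComplex (S : SSet.{w}) : Prop where
  hornFilling : ∀ ⦃n : ℕ⦄ ⦃i : Fin (n+1)⦄ (σ₀ : (Λ[n, i] : SSet.{w}) ⟶ S),
    ∃ σ : Δ[n] ⟶ S, σ₀ = Λ[n, i].ι ≫ σ

/-- A map of simplicial sets is a weak homotopy equivalence (in the Kan–Quillen sense)
iff for every Kan complex `K` the induced map on simplicial homotopy classes of maps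
into `K` is a bijection. -/
def IsWeakHomotopyEquiv {X Y : SSet.{w}} (f : X ⟶ Y) : Prop :=
  ∀ (K : SSet.{w}), KanComplex K →
    (∀ g : X ⟶ K, ∃ h : Y ⟶ K, Htpy (f ≫ h) g) ∧
    (∀ h h' : Y ⟶ K, Htpy (f ≫ h) (f ≫ h') → Htpy h h')

/-- A simplicial set is weakly contractible if its map to the terminal object
is a weak homotopy equivalence. -/
def WeaklyContractible (X : SSet.{w}) : Prop := IsWeakHomotopyEquiv (terminal.from X)

/-- The map on nerves induced by a functor. -/
def nerveMap {C : Type u} {D : Type u} [Category.{v} C] [Category.{v} D] (F : C ⥤ D) :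
    nerve C ⟶ nerve D where
  app m := ↾fun (G : ComposableArrows C m.unop.len) => (G ⋙ F : ComposableArrows D m.unop.len)
  naturality _ _ _ := rfl



/-- `f` is a retract of `g` in the arrow category. -/
def IsRetractOf {C : Type u} [Category.{v} C] {X Y X' Y' : C} (f : X ⟶ Y) (g : X' ⟶ Y') : Prop :=
  ∃ (i : X ⟶ X') (r : X' ⟶ X) (j : Y ⟶ Y') (s : Y' ⟶ Y),
    i ≫ r = 𝟙 X ∧ j ≫ s = 𝟙 Y ∧ i ≫ g = f ≫ j ∧ r ≫ f = g ≫ s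

/-- A (Quillen) model structure on a category: three wide subcategories of weak
equivalences, cofibrations and fibrations, satisfying the two-out-of-three, retract,
lifting and factorization axioms.  (No functorial factorizations are assumed; a model
category is a finitely bicomplete category equipped with such a structure.) -/
structure ModelStructure (C : Type u) [Category.{v} C] where
  W : MorphismProperty C
  Cof : MorphismProperty C
  Fib : MorphismProperty C
  W_id : ∀ X : C, W (𝟙 X)
  Cof_id : ∀ X : C, Cof (𝟙 X)
  Fib_id : ∀ X : C, Fib (𝟙 X)
  W_comp : ∀ {X Y Z : C} (f : X ⟶ Y) (g : Y ⟶ Z), W f → W g → W (f ≫ g)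
  Cof_comp : ∀ {X Y Z : C} (f : X ⟶ Y) (g : Y ⟶ Z), Cof f → Cof g → Cof (f ≫ g)
  Fib_comp : ∀ {X Y Z : C} (f : X ⟶ Y) (g : Y ⟶ Z), Fib f → Fib g → Fib (f ≫ g)
  W_of_precomp : ∀ {X Y Z : C} (f : X ⟶ Y) (g : Y ⟶ Z), W f → W (f ≫ g) → W g
  W_of_postcomp : ∀ {X Y Z : C} (f : X ⟶ Y) (g : Y ⟶ Z), W g → W (f ≫ g) → W f
  W_retract : ∀ {X Y X' Y' : C} {f : X ⟶ Y} {g : X' ⟶ Y'}, IsRetractOf f g → W g → W f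
  Cof_retract : ∀ {X Y X' Y' : C} {f : X ⟶ Y} {g : X' ⟶ Y'}, IsRetractOf f g → Cof g → Cof f
  Fib_retract : ∀ {X Y X' Y' : C} {f : X ⟶ Y} {g : X' ⟶ Y'}, IsRetractOf f g → Fib g → Fib f
  lifting_acof_fib : ∀ {A B X Y : C} (i : A ⟶ B) (p : X ⟶ Y),
    Cof i → W i → Fib p → HasLiftingProperty i p
  lifting_cof_afib : ∀ {A B X Y : C} (i : A ⟶ B) (p : X ⟶ Y),
    Cof i → Fib p → W p → HasLiftingProperty i p
  fact_acof_fib : ∀ {X Y : C} (f : X ⟶ Y),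
    ∃ (Z : C) (i : X ⟶ Z) (p : Z ⟶ Y), Cof i ∧ W i ∧ Fib p ∧ i ≫ p = f
  fact_cof_afib : ∀ {X Y : C} (f : X ⟶ Y),
    ∃ (Z : C) (i : X ⟶ Z) (p : Z ⟶ Y), Cof i ∧ Fib p ∧ W p ∧ i ≫ p = f

/-- An object is cofibrant if the map from an initial object is a cofibration. -/
def Cofibrant {C : Type u} [Category.{v} C] [HasInitial C] (M : ModelStructure C) (X : C) :
    Prop := M.Cof (initial.to X)

/-- An object is fibrant if the map to a terminal object is a fibration. -/
def Fibrant {C : Type u} [Category.{v} C] [HasTerminal C] (M : ModelStructure C) (X : C) :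
    Prop := M.Fib (terminal.from X)

/-- A category with a wide subcategory of weak equivalences (a relative category
whose weak equivalences form a wide subcategory). -/
structure RelCatStruct (R : Type u) [Category.{v} R] where
  W : MorphismProperty R
  W_id : ∀ X : R, W (𝟙 X)
  W_comp : ∀ {X Y Z : R} (f : X ⟶ Y) (g : Y ⟶ Z), W f → W g → W (f ≫ g)

/-- The underlying relative category of a model structure. -/
def ModelStructure.relcat {C : Type u} [Category.{v} C] (M : ModelStructure C) :
    RelCatStruct C :=
  ⟨M.W, M.W_id, M.W_comp⟩

/-- A Quillen adjunction between model categories: an adjunction `F ⊣ G` such that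
`F` preserves cofibrations and acyclic cofibrations. -/
structure QuillenAdjunction {C : Type u} {D : Type u} [Category.{v} C] [Category.{v} D]
    (MC : ModelStructure C) (MD : ModelStructure D) where
  F : C ⥤ D
  G : D ⥤ C
  adj : F ⊣ G
  F_cof : ∀ {X Y : C} (f : X ⟶ Y), MC.Cof f → MD.Cof (F.map f)
  F_acof : ∀ {X Y : C} (f : X ⟶ Y), MC.Cof f → MC.W f → MD.W (F.map f)


variable {C : Type u} {D : Type u} [Category.{v} C] [Category.{v} D]
variable [HasFiniteLimits C] [HasFiniteColimits C] [HasFiniteLimits D] [HasFiniteColimits D]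

/-- The category `Fun_{**}(3,(C^c+D^f))^W` of three-arrow zigzags `x ⟵ a ⇝ b ⟵ y` in the
collage of a Quillen adjunction: `a` is a cofibrant object of `C`, `b` is a fibrant object
of `D`, `f : a → x` is a weak equivalence of `C`, `g : F(a) → b` is a morphism of `D`
(a bridge morphism), and `h : y → b` is a weak equivalence of `D`.  Morphisms are pairs of
weak equivalences `u : a → a'` in `C` and `v : b → b'` in `D` commuting with everything. -/
structure Zig3Coll {MC : ModelStructure C} {MD : ModelStructure D}
    (Q : QuillenAdjunction MC MD) (x : C) (y : D) where
  a : C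
  b : D
  ha : Cofibrant MC a
  hb : Fibrant MD b
  f : a ⟶ x
  hf : MC.W f
  g : Q.F.obj a ⟶ b
  h : y ⟶ b
  hh : MD.W h

@[ext]
structure Zig3CollHom {MC : ModelStructure C} {MD : ModelStructure D}
    {Q : QuillenAdjunction MC MD} {x : C} {y : D} (A B : Zig3Coll Q x y) where
  u : A.a ⟶ B.a
  v : A.b ⟶ B.b
  hu : MC.W u
  hv : MD.W v
  comm_f : u ≫ B.f = A.f
  comm_g : Q.F.map u ≫ B.g = A.g ≫ v
  comm_h : A.h ≫ v = B.h

instance {MC : ModelStructure C} {MD : ModelStructure D}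
    {Q : QuillenAdjunction MC MD} {x : C} {y : D} : Category (Zig3Coll Q x y) where
  Hom := Zig3CollHom
  id A := ⟨𝟙 _, 𝟙 _, MC.W_id _, MD.W_id _, by simp, by simp, by simp⟩
  comp φ ψ := ⟨φ.u ≫ ψ.u, φ.v ≫ ψ.v, MC.W_comp _ _ φ.hu ψ.hu, MD.W_comp _ _ φ.hv ψ.hv,
    by rw [Category.assoc, ψ.comm_f, φ.comm_f],
    by rw [Q.F.map_comp, Category.assoc, ψ.comm_g, ← Category.assoc, φ.comm_g,
      Category.assoc],
    by rw [← Category.assoc, φ.comm_h, ψ.comm_h]⟩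
  id_comp _ := by apply Zig3CollHom.ext <;> simp
  comp_id _ := by apply Zig3CollHom.ext <;> simp
  assoc _ _ _ := by apply Zig3CollHom.ext <;> simp

section

open MonoidalCategory CartesianMonoidalCategory

lemma SHomotopy.of_tensor {X Y : SSet.{w}} {f g : X ⟶ Y} (H : X ⊗ Δ[1] ⟶ Y)
    (h₀ : SSet.ι₀ ≫ H = f) (h₁ : SSet.ι₁ ≫ H = g) : SHomotopy f g := by
  refine ⟨CartesianMonoidalCategory.lift Limits.prod.fst Limits.prod.snd ≫ H, ?_, ?_⟩
  · rw [← h₀, ← Category.assoc, CartesianMonoidalCategory.comp_lift, Limits.prod.lift_fst,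
      Limits.prod.lift_snd]
    rfl
  · rw [← h₁, ← Category.assoc, CartesianMonoidalCategory.comp_lift, Limits.prod.lift_fst,
      Limits.prod.lift_snd]
    rfl

lemma SHomotopy.exists_tensor {X Y : SSet.{w}} {f g : X ⟶ Y} (h : SHomotopy f g) :
    ∃ H : X ⊗ Δ[1] ⟶ Y, SSet.ι₀ ≫ H = f ∧ SSet.ι₁ ≫ H = g := by
  obtain ⟨H, rfl, rfl⟩ := h
  refine ⟨Limits.prod.lift (CartesianMonoidalCategory.fst _ _)
    (CartesianMonoidalCategory.snd _ _) ≫ H, ?_, ?_⟩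
  · rw [← Category.assoc, Limits.prod.comp_lift]
    rfl
  · rw [← Category.assoc, Limits.prod.comp_lift]
    rfl

lemma SHomotopy.precomp {X Y Z : SSet.{w}} {f g : Y ⟶ Z} (h : SHomotopy f g) (e : X ⟶ Y) :
    SHomotopy (e ≫ f) (e ≫ g) := by
  obtain ⟨H, rfl, rfl⟩ := h.exists_tensor
  exact .of_tensor (e ▷ _ ≫ H) rfl rfl

lemma SHomotopy.postcomp {X Y Z : SSet.{w}} {f g : X ⟶ Y} (h : SHomotopy f g) (e : Y ⟶ Z) :
    SHomotopy (f ≫ e) (g ≫ e) := by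
  obtain ⟨H, rfl, rfl⟩ := h.exists_tensor
  exact .of_tensor (H ≫ e) rfl rfl

lemma Htpy.refl {X Y : SSet.{w}} (f : X ⟶ Y) : Htpy f f := Relation.EqvGen.refl f

lemma Htpy.symm {X Y : SSet.{w}} {f g : X ⟶ Y} (h : Htpy f g) : Htpy g f :=
  Relation.EqvGen.symm _ _ h

lemma Htpy.trans {X Y : SSet.{w}} {f g k : X ⟶ Y} (h : Htpy f g) (h' : Htpy g k) : Htpy f k :=
  Relation.EqvGen.trans _ _ _ h h'

lemma SHomotopy.htpy {X Y : SSet.{w}} {f g : X ⟶ Y} (h : SHomotopy f g) : Htpy f g :=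
  Relation.EqvGen.rel _ _ h

lemma Htpy.precomp {X Y Z : SSet.{w}} {f g : Y ⟶ Z} (h : Htpy f g) (e : X ⟶ Y) :
    Htpy (e ≫ f) (e ≫ g) := by
  induction h with
  | rel _ _ h => exact (h.precomp e).htpy
  | refl => exact .refl _
  | symm _ _ _ h => exact h.symm
  | trans _ _ _ _ _ h h' => exact h.trans h'

lemma Htpy.postcomp {X Y Z : SSet.{w}} {f g : X ⟶ Y} (h : Htpy f g) (e : Y ⟶ Z) :
    Htpy (f ≫ e) (g ≫ e) := by
  induction h with
  | rel _ _ h => exact (h.postcomp e).htpy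
  | refl => exact .refl _
  | symm _ _ _ h => exact h.symm
  | trans _ _ _ _ _ h h' => exact h.trans h'

namespace IsWeakHomotopyEquiv

variable {X Y Z T : SSet.{w}}

lemma of_htpy {f g : X ⟶ Y} (hf : IsWeakHomotopyEquiv f) (h : Htpy f g) :
    IsWeakHomotopyEquiv g := fun K hK ↦
  ⟨fun a ↦ by
    obtain ⟨b, hb⟩ := (hf K hK).1 a
    exact ⟨b, (h.postcomp b).symm.trans hb⟩,
  fun b b' hb ↦ (hf K hK).2 b b' ((h.postcomp b).trans (hb.trans (h.postcomp b').symm))⟩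

lemma comp {f : X ⟶ Y} {g : Y ⟶ Z} (hf : IsWeakHomotopyEquiv f) (hg : IsWeakHomotopyEquiv g) :
    IsWeakHomotopyEquiv (f ≫ g) := fun K hK ↦
  ⟨fun a ↦ by
    obtain ⟨b, hb⟩ := (hf K hK).1 a
    obtain ⟨c, hc⟩ := (hg K hK).1 b
    refine ⟨c, ?_⟩
    rw [Category.assoc]
    exact (hc.precomp f).trans hb,
  fun b b' hb ↦ (hg K hK).2 b b' ((hf K hK).2 _ _ (by simpa only [Category.assoc] using hb))⟩

lemma of_comp_left {f : X ⟶ Y} {g : Y ⟶ Z} (hf : IsWeakHomotopyEquiv f)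
    (hfg : IsWeakHomotopyEquiv (f ≫ g)) : IsWeakHomotopyEquiv g := fun K hK ↦
  ⟨fun a ↦ by
    obtain ⟨b, hb⟩ := (hfg K hK).1 (f ≫ a)
    refine ⟨b, (hf K hK).2 _ _ ?_⟩
    simpa only [Category.assoc] using hb,
  fun b b' hb ↦ (hfg K hK).2 b b' (by simpa only [Category.assoc] using hb.precomp f)⟩

lemma of_comp_right {f : X ⟶ Y} {g : Y ⟶ Z} (hg : IsWeakHomotopyEquiv g)
    (hfg : IsWeakHomotopyEquiv (f ≫ g)) : IsWeakHomotopyEquiv f := fun K hK ↦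
  ⟨fun a ↦ by
    obtain ⟨b, hb⟩ := (hfg K hK).1 a
    exact ⟨g ≫ b, by simpa only [Category.assoc] using hb⟩,
  fun b b' hb ↦ by
    obtain ⟨c, hc⟩ := (hg K hK).1 b
    obtain ⟨c', hc'⟩ := (hg K hK).1 b'
    refine hc.symm.trans (Htpy.trans (Htpy.precomp ((hfg K hK).2 c c' ?_) g) hc')
    rw [Category.assoc, Category.assoc]
    exact (hc.precomp f).trans (hb.trans (hc'.precomp f).symm)⟩

lemma two_of_six {f : X ⟶ Y} {g : Y ⟶ Z} {k : Z ⟶ T} (hfg : IsWeakHomotopyEquiv (f ≫ g))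
    (hgk : IsWeakHomotopyEquiv (g ≫ k)) : IsWeakHomotopyEquiv k := fun K hK ↦
  ⟨fun a ↦ by
    obtain ⟨b, hb⟩ := (hgk K hK).1 (g ≫ a)
    refine ⟨b, (hfg K hK).2 _ _ ?_⟩
    simpa only [Category.assoc] using hb.precomp f,
  fun b b' hb ↦ (hgk K hK).2 b b' (by simpa only [Category.assoc] using hb.precomp g)⟩

lemma of_htpy_inverse {f : X ⟶ Y} {g : Y ⟶ X} (hfg : Htpy (f ≫ g) (𝟙 X))
    (hgf : Htpy (g ≫ f) (𝟙 Y)) : IsWeakHomotopyEquiv f := fun K _ ↦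
  ⟨fun a ↦ ⟨g ≫ a, by simpa only [Category.assoc, Category.id_comp] using hfg.postcomp a⟩,
  fun b b' hb ↦ by
    have h := hb.precomp g
    simp only [← Category.assoc] at h
    simpa only [Category.id_comp] using
      (hgf.postcomp b).symm.trans (h.trans (hgf.postcomp b'))⟩

end IsWeakHomotopyEquiv

/-- The homotopy between nerves induced by a natural transformation. -/
def nerveHomotopy {C : Type u} {D : Type u} [Category.{v} C] [Category.{v} D] {F G : C ⥤ D}
    (α : F ⟶ G) : nerve C ⊗ Δ[1] ⟶ nerve D where
  app m := ↾fun z ↦ (Functor.prod' (SSet.stdSimplex.objEquiv z.2).toOrderHom.monotone.functor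
    (show ComposableArrows C m.unop.len from z.1)) ⋙
      Functor.uncurry.obj (ComposableArrows.mk₁ α)
  naturality _ _ _ := rfl

lemma ι₀_nerveHomotopy {C : Type u} {D : Type u} [Category.{v} C] [Category.{v} D] {F G : C ⥤ D}
    (α : F ⟶ G) : SSet.ι₀ ≫ nerveHomotopy α = nerveMap F := by
  ext m z
  refine CategoryTheory.Functor.ext (fun k ↦ rfl) fun k l h ↦ ?_
  let c : ComposableArrows C m.unop.len := z
  change ((ComposableArrows.mk₁ α).map (𝟙 0)).app (c.obj k) ≫ F.map (c.map h) =
    𝟙 _ ≫ F.map (c.map h) ≫ 𝟙 _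
  rw [CategoryTheory.Functor.map_id]
  exact congrArg (𝟙 (F.obj (c.obj k)) ≫ ·) (Category.comp_id _).symm

lemma ι₁_nerveHomotopy {C : Type u} {D : Type u} [Category.{v} C] [Category.{v} D] {F G : C ⥤ D}
    (α : F ⟶ G) : SSet.ι₁ ≫ nerveHomotopy α = nerveMap G := by
  ext m z
  refine CategoryTheory.Functor.ext (fun k ↦ rfl) fun k l h ↦ ?_
  let c : ComposableArrows C m.unop.len := z
  change ((ComposableArrows.mk₁ α).map (𝟙 1)).app (c.obj k) ≫ G.map (c.map h) =
    𝟙 _ ≫ G.map (c.map h) ≫ 𝟙 _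
  rw [CategoryTheory.Functor.map_id]
  exact congrArg (𝟙 (G.obj (c.obj k)) ≫ ·) (Category.comp_id _).symm

lemma htpy_nerveMap {C : Type u} {D : Type u} [Category.{v} C] [Category.{v} D] {F G : C ⥤ D}
    (α : F ⟶ G) : Htpy (nerveMap F) (nerveMap G) :=
  (SHomotopy.of_tensor (nerveHomotopy α) (ι₀_nerveHomotopy α) (ι₁_nerveHomotopy α)).htpy

lemma IsWeakHomotopyEquiv.of_equivalence {C : Type u} {D : Type u} [Category.{v} C]
    [Category.{v} D] (e : C ≌ D) : IsWeakHomotopyEquiv (nerveMap e.functor) :=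
  .of_htpy_inverse (g := nerveMap e.inverse) (htpy_nerveMap e.unitIso.inv)
    (htpy_nerveMap e.counitIso.hom)

end

section

open MonoidalCategory CartesianMonoidalCategory HomotopicalAlgebra SSet.modelCategoryQuillen

lemma KanComplex.sset {K : SSet.{w}} (hK : KanComplex K) : SSet.KanComplex K := by
  rw [SSet.KanComplex, isFibrant_iff_of_isTerminal (terminal.from K) terminalIsTerminal,
    SSet.modelCategoryQuillen.fibration_iff]
  intro A B i hi
  simp only [SSet.modelCategoryQuillen.J, MorphismProperty.iSup_iff] at hi
  obtain ⟨n, ⟨k⟩⟩ := hi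
  refine ⟨fun {f g} sq ↦ ?_⟩
  obtain ⟨σ, hσ⟩ := hK.hornFilling f
  exact ⟨⟨⟨σ, hσ.symm, terminalIsTerminal.hom_ext _ _⟩⟩⟩

lemma stdSimplex_zero_ext {m : SimplexCategoryᵒᵖ} (s t : (Δ[0] : SSet.{w}).obj m) : s = t :=
  SSet.stdSimplex.objEquiv.injective (SimplexCategory.isTerminalZero.hom_ext _ _)

lemma anodyneExtensions_δ₀ (i : Fin 2) :
    SSet.anodyneExtensions (SSet.stdSimplex.{w}.map (SimplexCategory.const ⦋0⦌ ⦋1⦌ i)) := by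
  have hi : ∀ {m} (s : (Δ[1] : SSet.{w}).obj m), s ∈ Λ[1, i].obj m ↔
      s = (SSet.stdSimplex.{w}.map (SimplexCategory.const ⦋0⦌ ⦋1⦌ i)).app m
        (SSet.stdSimplex.objEquiv.symm (SimplexCategory.const _ _ 0)) := by
    intro m s
    induction m using Opposite.rec with | _ m =>
    induction m using SimplexCategory.rec with | _ m =>
    rw [SSet.mem_horn_iff_notMem_range]
    constructor
    · rintro ⟨j, hj, hs⟩
      ext k : 1
      simp only [Set.mem_range, not_exists] at hs
      have := hs k
      change _ = i
      generalize s k = a at *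
      fin_cases i <;> fin_cases j <;> fin_cases a <;> simp_all
    · rintro rfl
      refine ⟨i.rev, ?_, ?_⟩
      · fin_cases i <;> simp
      · rintro ⟨k, hk⟩
        change i = i.rev at hk
        fin_cases i <;> simp at hk
  let k : Δ[0] ⟶ (Λ[1, i] : SSet.{w}) := SSet.Subcomplex.lift
    (SSet.stdSimplex.map (SimplexCategory.const ⦋0⦌ ⦋1⦌ i)) (by
      rintro m _ ⟨s, rfl⟩
      rw [hi]
      congr 1
      exact stdSimplex_zero_ext _ _)
  let r : (Λ[1, i] : SSet.{w}) ⟶ Δ[0] := SSet.stdSimplex.isTerminalObj₀.from _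
  have hr : r ≫ SSet.stdSimplex.map (SimplexCategory.const ⦋0⦌ ⦋1⦌ i) = Λ[1, i].ι := by
    ext m s
    refine Eq.trans ?_ ((hi s.1).1 s.2).symm
    exact congrArg ((SSet.stdSimplex.map (SimplexCategory.const ⦋0⦌ ⦋1⦌ i)).app m)
      (stdSimplex_zero_ext _ _)
  refine (SSet.anodyneExtensions).of_retract (f := SSet.stdSimplex.map _) (g := Λ[1, i].ι)
    { i := Arrow.homMk k (𝟙 _) ?_
      r := Arrow.homMk r (𝟙 _) ?_
      retract := ?_ } (SSet.anodyneExtensions.horn_ι i)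
  · exact (SSet.Subcomplex.lift_ι _ _).trans (Category.comp_id _).symm
  · simpa using hr
  · ext : 1
    · exact SSet.stdSimplex.isTerminalObj₀.hom_ext _ _
    · simp

lemma exists_homotopy_lift {N M X Y : SSet.{w}} (j : N ⟶ M) [Mono j] (p : X ⟶ Y) [Fibration p]
    (a : N ⊗ Δ[1] ⟶ X) (l : M ⟶ X) (H : M ⊗ Δ[1] ⟶ Y)
    (h₁ : SSet.ι₀ ≫ a = j ≫ l) (h₂ : j ▷ _ ≫ H = a ≫ p) (h₃ : SSet.ι₀ ≫ H = l ≫ p) :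
    ∃ K : M ⊗ Δ[1] ⟶ X, j ▷ _ ≫ K = a ∧ SSet.ι₀ ≫ K = l ∧ K ≫ p = H := by
  let d := SSet.stdSimplex.{w}.map (SimplexCategory.const ⦋0⦌ ⦋1⦌ 0)
  have hι (Z : SSet.{w}) : Z ◁ d = fst _ _ ≫ SSet.ι₀ := by
    ext m : 3
    · rfl
    · rfl
  let sq := Functor.PushoutObjObj.ofHasPushout (curriedTensor SSet.{w}) j d
  have := SSet.anodyneExtensions_pushoutObjObjι sq (anodyneExtensions_δ₀ 0) p (mem_fibrations p)
  have hd : SSet.ι₀ = lift (𝟙 M) (SSet.stdSimplex.isTerminalObj₀.from M) ≫ M ◁ d := by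
    rw [hι, ← Category.assoc, lift_fst, Category.id_comp]
  let t : sq.pt ⟶ X := sq.isPushout.desc (fst _ _ ≫ l) a (by
    change j ▷ _ ≫ fst _ _ ≫ l = N ◁ d ≫ a
    rw [hι, Category.assoc, h₁, whiskerRight_fst_assoc])
  have ht : CommSq t sq.ι p H := ⟨by
    apply sq.hom_ext
    · rw [sq.inl_ι_assoc]
      change sq.inl ≫ t ≫ p = M ◁ d ≫ H
      rw [hι, IsPushout.inl_desc_assoc, Category.assoc, Category.assoc, h₃]
    · rw [sq.inr_ι_assoc]
      change sq.inr ≫ t ≫ p = j ▷ _ ≫ H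
      rw [IsPushout.inr_desc_assoc, h₂]⟩
  refine ⟨ht.lift, ?_, ?_, ht.fac_right⟩
  · have := sq.inr_ι_assoc ht.lift
    rw [ht.fac_left, IsPushout.inr_desc] at this
    exact this.symm
  · have := sq.inl_ι_assoc ht.lift
    rw [ht.fac_left, IsPushout.inl_desc] at this
    rw [hd, Category.assoc]
    change _ ≫ ((curriedTensor _).obj M).map d ≫ ht.lift = _
    rw [← this, lift_fst_assoc, Category.id_comp]

lemma boundary_one_apply {m : SimplexCategoryᵒᵖ} (s : (∂Δ[1] : SSet.{w}).obj m)
    (k : Fin (m.unop.len + 1)) :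
    SSet.stdSimplex.asOrderHom s.1 k = SSet.stdSimplex.asOrderHom s.1 0 := by
  have h : ¬ Function.Surjective (SSet.stdSimplex.asOrderHom s.1) := s.2
  by_contra hk
  apply h
  intro i
  generalize hb : SSet.stdSimplex.asOrderHom s.1 k = b at hk
  generalize hc : SSet.stdSimplex.asOrderHom s.1 0 = c at hk
  by_cases hi : i = b
  · exact ⟨k, hb.trans hi.symm⟩
  · exact ⟨0, hc.trans (by grind)⟩

/-- The map out of `X ⊗ ∂Δ[1]` given by two maps out of `X`. -/
def boundaryOneDesc {X Y : SSet.{w}} (f g : X ⟶ Y) : X ⊗ (∂Δ[1] : SSet.{w}) ⟶ Y where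
  app m := ↾fun z ↦ if SSet.stdSimplex.asOrderHom z.2.1 0 = 0 then f.app m z.1
    else g.app m z.1
  naturality m m' θ := by
    ext z
    have hs := boundary_one_apply z.2
    have hs' : SSet.stdSimplex.asOrderHom (((X ⊗ (∂Δ[1] : SSet.{w})).map θ z).2.1) 0 =
      SSet.stdSimplex.asOrderHom z.2.1 0 := hs (θ.unop.toOrderHom 0)
    change (if SSet.stdSimplex.asOrderHom (((X ⊗ (∂Δ[1] : SSet.{w})).map θ z).2.1) 0 = 0 then
      f.app m' (X.map θ z.1) else g.app m' (X.map θ z.1)) = Y.map θ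
        (if SSet.stdSimplex.asOrderHom z.2.1 0 = 0 then f.app m z.1 else g.app m z.1)
    rw [hs']
    split_ifs
    · exact NatTrans.naturality_apply f θ z.1
    · exact NatTrans.naturality_apply g θ z.1

lemma boundaryOneDesc_comp {X Y Z : SSet.{w}} (f g : X ⟶ Y) (e : Y ⟶ Z) :
    boundaryOneDesc f g ≫ e = boundaryOneDesc (f ≫ e) (g ≫ e) := by
  ext m z
  exact apply_ite _ _ _ _

lemma comp_boundaryOneDesc {X Y Z : SSet.{w}} (e : X ⟶ Y) (f g : Y ⟶ Z) :
    e ▷ _ ≫ boundaryOneDesc f g = boundaryOneDesc (e ≫ f) (e ≫ g) := rfl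

lemma ext_asOrderHom {n : ℕ} {m : SimplexCategoryᵒᵖ} {s t : (Δ[n] : SSet.{w}).obj m}
    (h : ∀ k, SSet.stdSimplex.asOrderHom s k = SSet.stdSimplex.asOrderHom t k) : s = t :=
  SSet.stdSimplex.objEquiv.injective (SimplexCategory.Hom.ext _ _ (OrderHom.ext _ _ (funext h)))

lemma whiskerLeft_boundary_ι {X Y : SSet.{w}} (H : X ⊗ Δ[1] ⟶ Y) :
    X ◁ (∂Δ[1] : (Δ[1] : SSet.{w}).Subcomplex).ι ≫ H =
      boundaryOneDesc (SSet.ι₀ ≫ H) (SSet.ι₁ ≫ H) := by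
  ext m z
  change H.app m (z.1, z.2.1) = if _ then H.app m (SSet.ι₀.app m z.1) else
    H.app m (SSet.ι₁.app m z.1)
  have hs := boundary_one_apply z.2
  split_ifs with h
  · congr 1
    refine Prod.ext rfl (ext_asOrderHom fun k ↦ ?_)
    rw [hs, h]
    rfl
  · congr 1
    refine Prod.ext rfl (ext_asOrderHom fun k ↦ ?_)
    rw [hs, Fin.eq_one_of_ne_zero _ h]
    rfl

lemma ends_of_whiskerLeft_boundary_ι {X Y : SSet.{w}} {H : X ⊗ Δ[1] ⟶ Y} {f g : X ⟶ Y}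
    (h : X ◁ (∂Δ[1] : (Δ[1] : SSet.{w}).Subcomplex).ι ≫ H = boundaryOneDesc f g) :
    SSet.ι₀ ≫ H = f ∧ SSet.ι₁ ≫ H = g := by
  have e (m) (x : X.obj m) (i : Fin 2) : ¬ Function.Surjective (SSet.stdSimplex.asOrderHom
      (SSet.stdSimplex.objEquiv.{w}.symm (SimplexCategory.const m.unop ⦋1⦌ i))) := by
    intro h
    obtain ⟨k, hk⟩ := h i.rev
    change i = i.rev at hk
    fin_cases i <;> simp at hk
  constructor
  · ext m x
    exact congr($(NatTrans.congr_app h m) (x, ⟨_, e m x 0⟩))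
  · ext m x
    exact congr($(NatTrans.congr_app h m) (x, ⟨_, e m x 1⟩))

end

section

open MonoidalCategory CartesianMonoidalCategory HomotopicalAlgebra SSet.modelCategoryQuillen MonoidalClosed

/-- The restriction maps `K ^ M ⟶ K ^ N` along monomorphisms `N ⟶ M`, where `K` is a Kan complex. -/
inductive restrictions : MorphismProperty (SSet.{w}) where
  | mk {N M : SSet.{w}} (j : N ⟶ M) [Mono j] (K : SSet.{w}) (hK : KanComplex K) :
    restrictions ((pre j).app K)

/-- The maps which have the left lifting property with respect to all restriction maps
`K ^ M ⟶ K ^ N`. Among monomorphisms, these are the acyclic cofibrations. -/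
def trivCof : MorphismProperty SSet.{w} := restrictions.llp
deriving MorphismProperty.IsMultiplicative, MorphismProperty.RespectsIso,
  MorphismProperty.IsStableUnderCobaseChange, MorphismProperty.IsStableUnderRetracts

lemma anodyneExtensions_le_trivCof : SSet.anodyneExtensions.{w} ≤ trivCof := by
  rintro A B f hf _ _ _ ⟨j, K, hK⟩
  have := hK.sset
  exact hf _ (mem_fibrations _)

lemma hasLiftingProperty_pre_iff {A B N M : SSet.{w}} (f : A ⟶ B) (j : N ⟶ M)
    (sq : (curriedTensor SSet.{w}).PushoutObjObj f j) (K : SSet.{w}) :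
    HasLiftingProperty sq.ι (terminal.from K) ↔ HasLiftingProperty j ((pre f).app K) :=
  internalHomAdjunction₂.hasLiftingProperty_iff sq
    (Functor.PullbackObjObj.ofIsTerminal internalHom f (terminal.from K) terminalIsTerminal)

lemma hasLiftingProperty_pre_swap {A B N M : SSet.{w}} (f : A ⟶ B) (j : N ⟶ M) (K : SSet.{w}) :
    HasLiftingProperty f ((pre j).app K) ↔ HasLiftingProperty j ((pre f).app K) := by
  let sq := Functor.PushoutObjObj.ofHasPushout (curriedTensor SSet.{w}) f j
  rw [← hasLiftingProperty_pre_iff f j sq, ← hasLiftingProperty_pre_iff j f sq.flipTensor]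
  exact (HasLiftingProperty.iff_of_arrow_iso_left
    (show Arrow.mk sq.ι ≅ Arrow.mk sq.flipTensor.ι from Arrow.isoMk (Iso.refl _) (β_ _ _)) _).symm

lemma trivCof_iff {A B : SSet.{w}} (f : A ⟶ B) :
    trivCof f ↔ ∀ (K : SSet.{w}), KanComplex K →
      (MorphismProperty.monomorphisms SSet.{w}).rlp ((pre f).app K) := by
  constructor
  · intro h K hK N M j (_ : Mono j)
    rw [← hasLiftingProperty_pre_swap]
    exact h _ ⟨j, K, hK⟩
  · rintro h _ _ _ ⟨j, K, hK⟩
    rw [hasLiftingProperty_pre_swap]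
    exact h K hK _ (.infer_property _)

lemma rlp_monomorphisms_of_comp {U V Z : SSet.{w}} (p : U ⟶ V) (q : V ⟶ Z) [Fibration p]
    (hq : (MorphismProperty.monomorphisms SSet.{w}).rlp q)
    (hpq : (MorphismProperty.monomorphisms SSet.{w}).rlp (p ≫ q)) :
    (MorphismProperty.monomorphisms SSet.{w}).rlp p := by
  rw [SSet.rlp_monomorphisms]
  rintro _ _ _ ⟨n⟩
  refine ⟨fun {t b} sq ↦ ?_⟩
  have := hpq (∂Δ[n] : (Δ[n] : SSet.{w}).Subcomplex).ι (.infer_property _)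
  have sq₁ : CommSq t (∂Δ[n] : (Δ[n] : SSet.{w}).Subcomplex).ι (p ≫ q) (b ≫ q) :=
    ⟨by rw [← Category.assoc, sq.w, Category.assoc]⟩
  let S := SSet.Subcomplex.unionProd.pushoutObjObj (∂Δ[n] : (Δ[n] : SSet.{w}).Subcomplex)
    (∂Δ[1] : (Δ[1] : SSet.{w}).Subcomplex)
  let T : S.pt ⟶ V := S.isPushout.desc (boundaryOneDesc (sq₁.lift ≫ p) b) (fst _ _ ≫ t ≫ p) (by
    change _ ▷ _ ≫ _ = _ ◁ _ ≫ _
    rw [comp_boundaryOneDesc, whiskerLeft_boundary_ι]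
    simp [sq.w])
  have : HasLiftingProperty S.ι q :=
    hq S.ι (inferInstanceAs (Mono (SSet.Subcomplex.ι _)))
  have sq₂ : CommSq T S.ι q (fst _ _ ≫ b ≫ q) := ⟨by
    apply S.isPushout.hom_ext
    · rw [IsPushout.inl_desc_assoc, S.inl_ι_assoc]
      change _ = _ ◁ _ ≫ _
      rw [boundaryOneDesc_comp, whiskerLeft_boundary_ι]
      simp
    · rw [IsPushout.inr_desc_assoc, S.inr_ι_assoc]
      change _ = _ ▷ _ ≫ _
      simp [sq.w_assoc]⟩
  have h₁ := S.inl_ι_assoc sq₂.lift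
  have h₂ := S.inr_ι_assoc sq₂.lift
  rw [sq₂.fac_left, IsPushout.inl_desc] at h₁
  rw [sq₂.fac_left, IsPushout.inr_desc] at h₂
  obtain ⟨h₃, h₄⟩ := ends_of_whiskerLeft_boundary_ι h₁.symm
  obtain ⟨H, h₅, h₆, h₇⟩ := exists_homotopy_lift (∂Δ[n] : (Δ[n] : SSet.{w}).Subcomplex).ι p
    (fst _ _ ≫ t) sq₁.lift sq₂.lift (by simp) (by simpa using h₂.symm) h₃
  refine ⟨⟨⟨SSet.ι₁ ≫ H, ?_, ?_⟩⟩⟩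
  · rw [← SSet.ι₁_comp_assoc, h₅]
    simp
  · rw [Category.assoc, h₇, h₄]

lemma trivCof.of_precomp {X Y Z : SSet.{w}} {f : X ⟶ Y} {g : Y ⟶ Z} [Mono g]
    (hf : trivCof f) (hfg : trivCof (f ≫ g)) : trivCof g := by
  rw [trivCof_iff] at hf hfg ⊢
  intro K hK
  have := hK.sset
  refine rlp_monomorphisms_of_comp _ _ (hf K hK) ?_
  have := hfg K hK
  rwa [pre_map, NatTrans.comp_app] at this

lemma trivCof.exists_extension {X Y K : SSet.{w}} {f : X ⟶ Y} (hf : trivCof f)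
    (hK : KanComplex K) (g : X ⟶ K) : ∃ h : Y ⟶ K, f ≫ h = g := by
  rw [trivCof_iff] at hf
  have := hf K hK (initial.to (𝟙_ SSet.{w})) (.infer_property _)
  rw [← hasLiftingProperty_pre_iff f _
    (.ofIsInitialRight (curriedTensor _) f _ initialIsInitial)] at this
  change HasLiftingProperty (f ▷ _) _ at this
  have sq : CommSq ((ρ_ _).hom ≫ g) (f ▷ 𝟙_ _) (terminal.from K) (terminal.from _) :=
    ⟨Subsingleton.elim _ _⟩
  refine ⟨(ρ_ _).inv ≫ sq.lift, ?_⟩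
  rw [rightUnitor_inv_naturality_assoc f, sq.fac_left, Iso.inv_hom_id_assoc]

lemma trivCof.htpy_of_sHomotopy {X Y K : SSet.{w}} {f : X ⟶ Y} (hf : trivCof f)
    (hK : KanComplex K) {h h' : Y ⟶ K} (H : SHomotopy (f ≫ h) (f ≫ h')) : SHomotopy h h' := by
  rw [trivCof_iff] at hf
  obtain ⟨H, h₀, h₁⟩ := H.exists_tensor
  have := hf K hK (∂Δ[1] : (Δ[1] : SSet.{w}).Subcomplex).ι (.infer_property _)
  let S := Functor.PushoutObjObj.ofHasPushout (curriedTensor SSet.{w}) f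
    (∂Δ[1] : (Δ[1] : SSet.{w}).Subcomplex).ι
  rw [← hasLiftingProperty_pre_iff f _ S] at this
  let T : S.pt ⟶ K := S.isPushout.desc (boundaryOneDesc h h') H (by
    change _ ▷ _ ≫ _ = _ ◁ _ ≫ _
    rw [comp_boundaryOneDesc, whiskerLeft_boundary_ι, h₀, h₁])
  have sq : CommSq T S.ι (terminal.from K) (terminal.from _) := ⟨Subsingleton.elim _ _⟩
  have h₁ := S.inl_ι_assoc sq.lift
  rw [sq.fac_left, IsPushout.inl_desc] at h₁
  obtain ⟨h₃, h₄⟩ := ends_of_whiskerLeft_boundary_ι h₁.symm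
  exact .of_tensor _ h₃ h₄

lemma trivCof.isWeakHomotopyEquiv {X Y : SSet.{w}} {f : X ⟶ Y} (hf : trivCof f) :
    IsWeakHomotopyEquiv f := by
  intro K hK
  constructor
  · intro g
    obtain ⟨h, rfl⟩ := hf.exists_extension hK g
    exact ⟨h, .refl _⟩
  · suffices ∀ g g' : X ⟶ K, Htpy g g' → ∀ h h' : Y ⟶ K, f ≫ h = g → f ≫ h' = g' → Htpy h h' from
      fun h h' H ↦ this _ _ H _ _ rfl rfl
    intro g g' H
    induction H with
    | rel _ _ H =>
      rintro h h' rfl rfl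
      exact (hf.htpy_of_sHomotopy hK H).htpy
    | refl g =>
      rintro h h' rfl e
      refine (hf.htpy_of_sHomotopy hK ?_).htpy
      rw [e]
      exact .of_tensor (fst _ _ ≫ f ≫ h) (by simp) (by simp)
    | symm _ _ _ ih => exact fun h h' e e' ↦ (ih _ _ e' e).symm
    | trans _ g₂ _ _ _ ih ih' =>
      intro h h' e e'
      obtain ⟨k, hk⟩ := hf.exists_extension hK g₂
      exact (ih _ _ e hk).trans (ih' _ _ hk e')

end

section

open MonoidalCategory CartesianMonoidalCategory

lemma map_op_comp_apply (X : SSet.{w}) {a b c : SimplexCategory} (f : a ⟶ b) (g : b ⟶ c)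
    (x : X.obj (.op c)) : X.map (f ≫ g).op x = X.map f.op (X.map g.op x) := by
  rw [op_comp, X.map_comp]; rfl

lemma map_op_id_apply (X : SSet.{w}) {a : SimplexCategory} (x : X.obj (.op a)) :
    X.map (𝟙 a).op x = x := by
  rw [op_id, X.map_id]; rfl

/-- The objects of the category of simplices of a simplicial set, with injective operators
as morphisms. -/
structure Simplices (X : SSet.{w}) : Type w where
  dim : SemiSimplexCategory
  simplex : X.obj (.op (SemiSimplexCategory.toSimplexCategory.obj dim))

namespace Simplices

variable {X Y Z : SSet.{w}}

/-- The morphisms in the category of simplices. -/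
structure Hom (p q : Simplices X) : Type where
  face : @Quiver.Hom SemiSimplexCategory CategoryStruct.toQuiver p.dim q.dim
  map_simplex : X.map (SemiSimplexCategory.toSimplexCategory.map face).op q.simplex = p.simplex

lemma Hom.ext {p q : Simplices X} {φ ψ : Hom p q} (h : φ.face = ψ.face) : φ = ψ := by
  cases φ; cases ψ; cases h; rfl

instance : Category.{0} (Simplices X) where
  Hom := Hom
  id p := ⟨𝟙 _, by rw [CategoryTheory.Functor.map_id, map_op_id_apply]⟩
  comp {p q r} φ ψ := ⟨φ.face ≫ ψ.face, by
    rw [Functor.map_comp, map_op_comp_apply, ψ.map_simplex, φ.map_simplex]⟩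
  id_comp _ := Hom.ext (Category.id_comp _)
  comp_id _ := Hom.ext (Category.comp_id _)
  assoc _ _ _ := Hom.ext (Category.assoc _ _ _)


/-- The dimension functor. -/
def dimFunctor (X : SSet.{w}) : Simplices X ⥤ SemiSimplexCategory where
  obj p := p.dim
  map φ := φ.face

/-- The functor induced by a map of simplicial sets. -/
def map (f : X ⟶ Y) : Simplices X ⥤ Simplices Y where
  obj p := ⟨p.dim, f.app _ p.simplex⟩
  map {p q} φ := ⟨φ.face,
    (NatTrans.naturality_apply f _ _).symm.trans (congrArg _ φ.map_simplex)⟩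

/-- The operator given by the last vertices of a chain of simplices. -/
def lastVertices {m : ℕ} (c : ComposableArrows SemiSimplexCategory m) :
    ⦋m⦌ ⟶ SemiSimplexCategory.toSimplexCategory.obj (c.obj (Fin.last m)) :=
  SimplexCategory.Hom.mk
    { toFun i := SemiSimplexCategory.homEquiv (c.map (homOfLE (Fin.le_last i))) (Fin.last _)
      monotone' i j h := by
        have : c.map (homOfLE (Fin.le_last i)) = c.map (homOfLE h) ≫
          c.map (homOfLE (Fin.le_last j)) := by rw [← c.map_comp]; rfl
        dsimp only
        rw [this, SemiSimplexCategory.homEquiv_comp]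
        exact (SemiSimplexCategory.homEquiv (c.map (homOfLE (Fin.le_last j)))).monotone
          (Fin.le_last _) }

lemma homEquiv_comp_apply {a b c : SemiSimplexCategory} (f : a ⟶ b) (g : b ⟶ c)
    (j : Fin (a.len + 1)) : SemiSimplexCategory.homEquiv (f ≫ g) j =
      SemiSimplexCategory.homEquiv g (SemiSimplexCategory.homEquiv f j) := by
  rw [SemiSimplexCategory.homEquiv_comp]; rfl

lemma toOrderHom_comp_map {a : SimplexCategory} {b c : SemiSimplexCategory}
    (f : a ⟶ SemiSimplexCategory.toSimplexCategory.obj b) (g : b ⟶ c) (j : Fin (a.len + 1)) :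
    (f ≫ SemiSimplexCategory.toSimplexCategory.map g).toOrderHom j =
      SemiSimplexCategory.homEquiv g (f.toOrderHom j) := rfl

lemma lastVertices_comp {m m' : ℕ} (c : ComposableArrows SemiSimplexCategory m) (φ : ⦋m'⦌ ⟶ ⦋m⦌) :
    lastVertices (φ.toOrderHom.monotone.functor ⋙ c) ≫
      SemiSimplexCategory.toSimplexCategory.map
        (c.map (homOfLE (Fin.le_last (φ.toOrderHom (Fin.last _))))) = φ ≫ lastVertices c := by
  apply SimplexCategory.Hom.ext
  apply OrderHom.ext
  funext j
  have h : c.map (homOfLE (φ.toOrderHom.monotone (Fin.le_last j))) ≫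
      c.map (homOfLE (Fin.le_last (φ.toOrderHom (Fin.last _)))) =
        c.map (homOfLE (Fin.le_last (φ.toOrderHom j))) := by
    rw [← c.map_comp]; rfl
  exact (toOrderHom_comp_map _ _ _).trans
    ((homEquiv_comp_apply _ _ _).symm.trans
      (congrArg (fun χ ↦ SemiSimplexCategory.homEquiv χ (Fin.last _)) h))

end Simplices

open Simplices

/-- The nerve of the category of simplices, as a functor. -/
def nerveSimplices : SSet.{w} ⥤ SSet.{w} where
  obj X := nerve (Simplices X)
  map f :=
    { app m := ↾fun (G : ComposableArrows _ m.unop.len) ↦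
        (G ⋙ Simplices.map f : ComposableArrows _ m.unop.len)
      naturality _ _ _ := rfl }

/-- The last vertex map. -/
def lastVertexMap : nerveSimplices.{w} ⟶ 𝟭 _ where
  app X :=
    { app m := ↾fun (G : ComposableArrows (Simplices X) m.unop.len) ↦
        X.map (lastVertices (G ⋙ dimFunctor X)).op (G.obj (Fin.last _)).simplex
      naturality m m' φ := by
        ext G
        let c : ComposableArrows (Simplices X) m.unop.len := G
        let i : Fin (m.unop.len + 1) := φ.unop.toOrderHom (Fin.last _)
        let ψ : c.obj i ⟶ c.obj (Fin.last _) := c.map (homOfLE (Fin.le_last i))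
        let c' : ComposableArrows (Simplices X) m'.unop.len := (nerve _).map φ G
        have h : lastVertices (c' ⋙ dimFunctor X) ≫
            SemiSimplexCategory.toSimplexCategory.map ψ.face =
              φ.unop ≫ lastVertices (c ⋙ dimFunctor X) :=
          lastVertices_comp (c ⋙ dimFunctor X) φ.unop
        change X.map (lastVertices (c' ⋙ dimFunctor X)).op (c.obj i).simplex =
          X.map φ.unop.op (X.map (lastVertices (c ⋙ dimFunctor X)).op (c.obj (Fin.last _)).simplex)
        rw [← ψ.map_simplex]
        exact (map_op_comp_apply _ _ _ _).symm.trans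
          ((congrArg (fun χ ↦ X.map (Quiver.Hom.op χ) (c.obj (Fin.last _)).simplex) h).trans
            (map_op_comp_apply _ _ _ _)) }
  naturality X Y f := by
    ext m G
    exact NatTrans.naturality_apply f _ _ |>.symm

end

section

open MonoidalCategory CartesianMonoidalCategory

/-- A functor to types which decomposes as a disjoint union of functors preserving colimits
preserves colimits. -/
lemma preservesColimitsOfShape_of_sigma {𝒳 : Type*} [Category* 𝒳] {J : Type*} [Category* J]
    {H : 𝒳 ⥤ Type w} {I : Type*} (F : I → 𝒳 ⥤ Type w) [∀ i, PreservesColimitsOfShape J (F i)]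
    (ι : ∀ i, F i ⟶ H)
    (hι : ∀ X, Function.Bijective (fun p : Σ i, (F i).obj X ↦ (ι p.1).app X p.2)) :
    PreservesColimitsOfShape J H where
  preservesColimit {K} :=
    { preserves := fun {c} hc ↦ by
        let cc (s : Cocone (K ⋙ H)) (i : I) : Cocone (K ⋙ F i) :=
          { pt := s.pt
            ι := Functor.whiskerLeft K (ι i) ≫ s.ι }
        let e := Equiv.ofBijective _ (hι c.pt)
        let d (s : Cocone (K ⋙ H)) (p : Σ i, (F i).obj c.pt) : s.pt :=
          (isColimitOfPreserves (F p.1) hc).desc (cc s p.1) p.2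
        have hd (s : Cocone (K ⋙ H)) (j : J) (p : Σ i, (F i).obj (K.obj j)) :
            d s (e.symm (H.map (c.ι.app j) ((ι p.1).app _ p.2))) =
              s.ι.app j ((ι p.1).app _ p.2) := by
          have : H.map (c.ι.app j) ((ι p.1).app _ p.2) = e ⟨p.1, (F p.1).map (c.ι.app j) p.2⟩ :=
            (NatTrans.naturality_apply (ι p.1) (c.ι.app j) p.2).symm
          rw [this, Equiv.symm_apply_apply]
          exact ConcreteCategory.congr_hom
            ((isColimitOfPreserves (F p.1) hc).fac (cc s p.1) j) p.2
        refine ⟨{ desc := fun s ↦ ↾fun t ↦ d s (e.symm t), fac := ?_, uniq := ?_ }⟩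
        · intro s j
          ext t
          obtain ⟨p, rfl⟩ := (hι _).2 t
          exact hd s j p
        · intro s m hm
          ext t
          obtain ⟨p, rfl⟩ := e.surjective t
          have : (ι p.1).app c.pt ≫ m = (isColimitOfPreserves (F p.1) hc).desc (cc s p.1) := by
            refine (isColimitOfPreserves (F p.1) hc).hom_ext fun j ↦ ?_
            rw [IsColimit.fac]
            exact (NatTrans.naturality_assoc (ι p.1) (c.ι.app j) m).trans
              (congrArg ((ι p.1).app _ ≫ ·) (hm j))
          change _ = d s (e.symm (e p))
          rw [Equiv.symm_apply_apply]
          exact ConcreteCategory.congr_hom this p.2 }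

namespace Simplices

variable {X Y : SSet.{w}}

/-- Constructor for functors to the category of simplices. -/
def functorMk {𝒟 : Type*} [Category* 𝒟] (d : 𝒟 ⥤ SemiSimplexCategory)
    (s : ∀ i, X.obj (.op (SemiSimplexCategory.toSimplexCategory.obj (d.obj i))))
    (h : ∀ ⦃i j : 𝒟⦄ (φ : i ⟶ j),
      X.map (SemiSimplexCategory.toSimplexCategory.map (d.map φ)).op (s j) = s i) :
    𝒟 ⥤ Simplices X where
  obj i := ⟨d.obj i, s i⟩
  map φ := ⟨d.map φ, h φ⟩
  map_id _ := Hom.ext (d.map_id _)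
  map_comp _ _ := Hom.ext (d.map_comp _ _)

lemma functorMk_congr {𝒟 : Type*} [Category* 𝒟] (d : 𝒟 ⥤ SemiSimplexCategory)
    {s s' : ∀ i, X.obj (.op (SemiSimplexCategory.toSimplexCategory.obj (d.obj i)))}
    (h : ∀ ⦃i j : 𝒟⦄ (φ : i ⟶ j),
      X.map (SemiSimplexCategory.toSimplexCategory.map (d.map φ)).op (s j) = s i)
    (h' : ∀ ⦃i j : 𝒟⦄ (φ : i ⟶ j),
      X.map (SemiSimplexCategory.toSimplexCategory.map (d.map φ)).op (s' j) = s' i)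
    (hs : ∀ i, s i = s' i) : functorMk d s h = functorMk d s' h' := by
  obtain rfl : s = s' := funext hs
  rfl

/-- The chain of simplices with a given last simplex. -/
def chain {m : ℕ} (c : ComposableArrows SemiSimplexCategory m)
    (x : X.obj (.op (SemiSimplexCategory.toSimplexCategory.obj (c.obj (Fin.last m))))) :
    ComposableArrows (Simplices X) m :=
  functorMk c (fun i ↦ X.map
    (SemiSimplexCategory.toSimplexCategory.map (c.map (homOfLE (Fin.le_last i)))).op x)
    (fun i j φ ↦ by
      rw [← map_op_comp_apply, ← Functor.map_comp, ← c.map_comp]; rfl)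

lemma chain_comp_map {m : ℕ} (c : ComposableArrows SemiSimplexCategory m)
    (x : X.obj (.op (SemiSimplexCategory.toSimplexCategory.obj (c.obj (Fin.last m)))))
    (f : X ⟶ Y) : (chain c x ⋙ map f : ComposableArrows _ m) = chain c (f.app _ x) :=
  functorMk_congr _ _ _ (fun _ ↦ NatTrans.naturality_apply f _ _)

lemma chain_last {m : ℕ} (c : ComposableArrows SemiSimplexCategory m)
    (x : X.obj (.op (SemiSimplexCategory.toSimplexCategory.obj (c.obj (Fin.last m))))) :
    ((chain c x).obj (Fin.last m)).simplex = x := by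
  refine Eq.trans ?_ (map_op_id_apply X x)
  change X.map (SemiSimplexCategory.toSimplexCategory.map (c.map (𝟙 _))).op x = _
  rw [c.map_id, CategoryTheory.Functor.map_id]

lemma chain_eq {m : ℕ} (G : ComposableArrows (Simplices X) m) :
    chain (G ⋙ dimFunctor X) (G.obj (Fin.last m)).simplex = G :=
  functorMk_congr _ _ _ (fun i ↦ (G.map (homOfLE (Fin.le_last i))).map_simplex)

end Simplices

open Simplices

instance : PreservesColimitsOfSize.{w, w} nerveSimplices.{w} where
  preservesColimitsOfShape {J} _ := preservesColimitsOfShape_of_evaluation _ _ fun m ↦ by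
    refine preservesColimitsOfShape_of_sigma
      (I := ComposableArrows SemiSimplexCategory m.unop.len)
      (fun c ↦ (evaluation _ _).obj
        (.op (SemiSimplexCategory.toSimplexCategory.obj (c.obj (Fin.last _)))))
      (fun c ↦ { app X := ↾fun x ↦ chain c x, naturality X Y f := ?_ }) (fun X ↦ ⟨?_, ?_⟩)
    · ext x
      exact (chain_comp_map c x f).symm
    · rintro ⟨c, x⟩ ⟨c', x'⟩ h
      have h₁ : chain c x = chain c' x' := h
      obtain rfl : c = c' := congrArg (fun G ↦ G ⋙ dimFunctor X) h₁
      have h₂ : x = x' := eq_of_heq ((heq_of_eq (chain_last c x).symm).trans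
        ((congr_arg_heq (fun G ↦ (G.obj (Fin.last _)).simplex) h₁).trans
          (heq_of_eq (chain_last c x'))))
      rw [h₂]
    · exact fun G ↦ ⟨⟨_, _⟩, chain_eq G⟩

end

section

open MonoidalCategory CartesianMonoidalCategory

lemma anodyneExtensions_ι₁ (X : SSet.{w}) : SSet.anodyneExtensions (SSet.ι₁ (X := X)) := by
  let e : X ≅ X ⊗ Δ[0] :=
    { hom := lift (𝟙 X) (SSet.stdSimplex.isTerminalObj₀.from X)
      inv := fst _ _
      inv_hom_id := CartesianMonoidalCategory.hom_ext _ _ rfl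
        (SSet.stdSimplex.isTerminalObj₀.hom_ext _ _) }
  have : SSet.ι₁ = e.hom ≫ X ◁ SSet.stdSimplex.map (SimplexCategory.const ⦋0⦌ ⦋1⦌ 1) := rfl
  rw [this]
  exact MorphismProperty.RespectsLeft.precomp (P := SSet.anodyneExtensions)
    (Q := .isomorphisms _) e.hom e.isIso_hom _
    ((anodyneExtensions_δ₀ 1).whiskerLeft X)

lemma anodyneExtensions_ι₀ (X : SSet.{w}) : SSet.anodyneExtensions (SSet.ι₀ (X := X)) := by
  let e : X ≅ X ⊗ Δ[0] :=
    { hom := lift (𝟙 X) (SSet.stdSimplex.isTerminalObj₀.from X)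
      inv := fst _ _
      inv_hom_id := CartesianMonoidalCategory.hom_ext _ _ rfl
        (SSet.stdSimplex.isTerminalObj₀.hom_ext _ _) }
  have : SSet.ι₀ = e.hom ≫ X ◁ SSet.stdSimplex.map (SimplexCategory.const ⦋0⦌ ⦋1⦌ 0) := rfl
  rw [this]
  exact MorphismProperty.RespectsLeft.precomp (P := SSet.anodyneExtensions)
    (Q := .isomorphisms _) e.hom e.isIso_hom _
    ((anodyneExtensions_δ₀ 0).whiskerLeft X)

/-- The simplex of `Δ[1]` which is constant at a vertex. -/
def constSimplex (i : Fin 2) (m : SimplexCategoryᵒᵖ) : (Δ[1] : SSet.{w}).obj m :=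
  ULift.up (SimplexCategory.const m.unop ⦋1⦌ i)

lemma constSimplex_zero_ne_one (m : SimplexCategoryᵒᵖ) :
    constSimplex.{w} 0 m ≠ constSimplex 1 m := fun h ↦
  zero_ne_one (α := Fin 2) (congrArg (fun s ↦ SSet.stdSimplex.asOrderHom s 0) h :)

section

variable {A X : SSet.{w}} (f : A ⟶ X)

/-- The simplices of the mapping cylinder of a map of simplicial sets. -/
abbrev CylinderSimplices (_ : A ⟶ X) (m : SimplexCategoryᵒᵖ) : Type w :=
  X.obj m ⊕ A.obj m × {s : (Δ[1] : SSet.{w}).obj m // s ≠ constSimplex 1 m}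

open Classical in
/-- The simplex of the mapping cylinder given by a simplex of the cylinder. -/
noncomputable def cylinderMk {m : SimplexCategoryᵒᵖ} (z : (A ⊗ (Δ[1] : SSet.{w})).obj m) :
    CylinderSimplices f m :=
  if h : z.2 = constSimplex 1 m then .inl (f.app m z.1) else .inr (z.1, ⟨z.2, h⟩)

lemma cylinderMk_of_eq {m : SimplexCategoryᵒᵖ} (z : (A ⊗ (Δ[1] : SSet.{w})).obj m)
    (h : z.2 = constSimplex 1 m) : cylinderMk f z = .inl (f.app m z.1) := dif_pos h

lemma cylinderMk_of_ne {m : SimplexCategoryᵒᵖ} (z : (A ⊗ (Δ[1] : SSet.{w})).obj m)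
    (h : z.2 ≠ constSimplex 1 m) : cylinderMk f z = .inr (z.1, ⟨z.2, h⟩) := dif_neg h

/-- The action of simplicial operators on the simplices of the mapping cylinder. -/
noncomputable def cylinderMap {m m' : SimplexCategoryᵒᵖ} (φ : m ⟶ m') :
    CylinderSimplices f m → CylinderSimplices f m' :=
  Sum.elim (fun x ↦ .inl (X.map φ x))
    (fun p ↦ cylinderMk f ((A ⊗ (Δ[1] : SSet.{w})).map φ (p.1, p.2.1)))

lemma cylinderMap_cylinderMk {m m' : SimplexCategoryᵒᵖ} (φ : m ⟶ m')
    (z : (A ⊗ (Δ[1] : SSet.{w})).obj m) :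
    cylinderMap f φ (cylinderMk f z) = cylinderMk f ((A ⊗ (Δ[1] : SSet.{w})).map φ z) := by
  by_cases h : z.2 = constSimplex 1 m
  · rw [cylinderMk_of_eq f z h, cylinderMk_of_eq f]
    · exact congrArg Sum.inl (NatTrans.naturality_apply f φ z.1).symm
    · exact congrArg ((Δ[1] : SSet.{w}).map φ) h
  · rw [cylinderMk_of_ne f z h]
    rfl

/-- The mapping cylinder of a map of simplicial sets. -/
noncomputable def mappingCylinder : SSet.{w} where
  obj m := CylinderSimplices f m
  map φ := ↾(cylinderMap f φ)
  map_id m := by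
    ext (x | p)
    · exact congrArg Sum.inl (ConcreteCategory.congr_hom (X.map_id m) x)
    · refine Eq.trans (congrArg (cylinderMk f)
        (ConcreteCategory.congr_hom ((A ⊗ (Δ[1] : SSet.{w})).map_id m) _)) ?_
      exact cylinderMk_of_ne f (p.1, p.2.1) p.2.2
  map_comp φ ψ := by
    ext (x | p)
    · exact congrArg Sum.inl (ConcreteCategory.congr_hom (X.map_comp φ ψ) x)
    · refine Eq.trans (congrArg (cylinderMk f)
        (ConcreteCategory.congr_hom ((A ⊗ (Δ[1] : SSet.{w})).map_comp φ ψ) _)) ?_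
      exact (cylinderMap_cylinderMk f ψ _).symm

namespace mappingCylinder

/-- The map from the cylinder to the mapping cylinder. -/
noncomputable def ofCylinder : A ⊗ (Δ[1] : SSet.{w}) ⟶ mappingCylinder f where
  app m := ↾(cylinderMk f)
  naturality _ _ φ := by
    ext z
    exact (cylinderMap_cylinderMk f φ z).symm

/-- The inclusion of the target in the mapping cylinder. -/
noncomputable def inl : X ⟶ mappingCylinder f where
  app m := ↾Sum.inl
  naturality _ _ _ := rfl

lemma condition : SSet.ι₁ ≫ ofCylinder f = f ≫ inl f := by
  ext m a
  exact cylinderMk_of_eq f _ rfl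

/-- The inclusion of the source in the mapping cylinder. -/
noncomputable def inr : A ⟶ mappingCylinder f := SSet.ι₀ ≫ ofCylinder f

lemma inr_apply {m : SimplexCategoryᵒᵖ} (a : A.obj m) :
    (inr f).app m a = Sum.inr (a, ⟨_, constSimplex_zero_ne_one m⟩) :=
  cylinderMk_of_ne f _ (constSimplex_zero_ne_one _)

instance : Mono (inr f) := by
  refine (NatTrans.mono_iff_mono_app _).2 fun m ↦ (mono_iff_injective _).2 fun a a' h ↦ ?_
  exact congrArg Prod.fst (Sum.inr_injective ((inr_apply f a).symm.trans (h.trans (inr_apply f a'))))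

variable {f} in
/-- The universal property of the mapping cylinder. -/
noncomputable def desc {Z : SSet.{w}} (H : A ⊗ (Δ[1] : SSet.{w}) ⟶ Z) (g : X ⟶ Z)
    (h : SSet.ι₁ ≫ H = f ≫ g) : mappingCylinder f ⟶ Z := by
  let d (m : SimplexCategoryᵒᵖ) : CylinderSimplices f m → Z.obj m :=
    Sum.elim (g.app m) (fun p ↦ H.app m (p.1, p.2.1))
  have hd (m) (z : (A ⊗ (Δ[1] : SSet.{w})).obj m) : d m (cylinderMk f z) = H.app m z := by
    by_cases hz : z.2 = constSimplex 1 m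
    · rw [cylinderMk_of_eq f z hz]
      refine (ConcreteCategory.congr_hom (NatTrans.congr_app h m) z.1).symm.trans ?_
      exact congrArg (H.app m) (Prod.ext rfl hz.symm)
    · rw [cylinderMk_of_ne f z hz]
      rfl
  exact
    { app m := ↾(d m)
      naturality _ m' φ := by
        ext (x | p)
        · exact NatTrans.naturality_apply g φ x
        · exact (hd m' _).trans (NatTrans.naturality_apply H φ _) }

section

variable {Z : SSet.{w}} (H : A ⊗ (Δ[1] : SSet.{w}) ⟶ Z) (g : X ⟶ Z) (h : SSet.ι₁ ≫ H = f ≫ g)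

lemma inl_desc : inl f ≫ desc H g h = g := rfl

lemma ofCylinder_desc : ofCylinder f ≫ desc H g h = H := by
  ext m z
  change Sum.elim (g.app m) (fun p ↦ H.app m (p.1, p.2.1)) (cylinderMk f z) = _
  by_cases hz : z.2 = constSimplex 1 m
  · rw [cylinderMk_of_eq f z hz]
    refine (ConcreteCategory.congr_hom (NatTrans.congr_app h m) z.1).symm.trans ?_
    exact congrArg (H.app m) (Prod.ext rfl hz.symm)
  · rw [cylinderMk_of_ne f z hz]
    rfl

end

lemma hom_ext {Z : SSet.{w}} {p q : mappingCylinder f ⟶ Z} (h : ofCylinder f ≫ p = ofCylinder f ≫ q)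
    (h' : inl f ≫ p = inl f ≫ q) : p = q := by
  ext m (x | z)
  · exact ConcreteCategory.congr_hom (NatTrans.congr_app h' m) x
  · have := ConcreteCategory.congr_hom (NatTrans.congr_app h m) ((z.1, z.2.1) : A.obj m × _)
    have e : (ofCylinder f).app m (z.1, z.2.1) = Sum.inr z := cylinderMk_of_ne f _ z.2.2
    change p.app m ((ofCylinder f).app m (z.1, z.2.1)) =
      q.app m ((ofCylinder f).app m (z.1, z.2.1)) at this
    rwa [e] at this

lemma isPushout : IsPushout SSet.ι₁ f (ofCylinder f) (inl f) where
  w := condition f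
  isColimit' := ⟨PushoutCocone.IsColimit.mk _ (fun s ↦ desc s.inl s.inr s.condition)
    (fun _ ↦ ofCylinder_desc _ _ _ _) (fun _ ↦ inl_desc _ _ _ _)
    (fun _ _ h h' ↦ hom_ext f (h.trans (ofCylinder_desc _ _ _ _).symm)
      (h'.trans (inl_desc _ _ _ _).symm))⟩

/-- The retraction of the mapping cylinder on the target. -/
noncomputable def toTarget : mappingCylinder f ⟶ X := desc (fst _ _ ≫ f) (𝟙 X) rfl

lemma inr_toTarget : inr f ≫ toTarget f = f :=
  congrArg (SSet.ι₀ ≫ ·) (ofCylinder_desc f (fst _ _ ≫ f) (𝟙 X) rfl)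

/-- The projection of the mapping cylinder to the interval. -/
noncomputable def toInterval : mappingCylinder f ⟶ Δ[1] :=
  desc (snd _ _) (constVertex X 1) rfl

lemma ofCylinder_toInterval : ofCylinder f ≫ toInterval f = snd _ _ :=
  ofCylinder_desc f (snd _ _) (constVertex X 1) rfl

lemma trivCof_inl : trivCof (inl f) :=
  MorphismProperty.of_isPushout (P := trivCof) (isPushout f).flip
    (anodyneExtensions_le_trivCof _ (anodyneExtensions_ι₁ A))

end mappingCylinder

end

end

section

section
variable {C₁ C₂ C₃ : Type*} [Category* C₁] [Category* C₂] [Category* C₃]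

/-- The bifunctor of right adjoints attached to a bifunctor. -/
noncomputable def rightAdjoints (F : C₁ ⥤ C₂ ⥤ C₃) [∀ X, (F.obj X).IsLeftAdjoint] :
    C₁ᵒᵖ ⥤ C₃ ⥤ C₂ where
  obj X := (F.obj X.unop).rightAdjoint
  map f := conjugateEquiv (.ofIsLeftAdjoint _) (.ofIsLeftAdjoint _) (F.map f.unop)
  map_id X := by rw [unop_id, CategoryTheory.Functor.map_id, conjugateEquiv_id]
  map_comp f g := by rw [unop_comp, CategoryTheory.Functor.map_comp, conjugateEquiv_comp]

/-- The parametrized adjunction attached to a bifunctor. -/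
noncomputable def parametrizedAdjunction (F : C₁ ⥤ C₂ ⥤ C₃) [∀ X, (F.obj X).IsLeftAdjoint] :
    F ⊣₂ rightAdjoints F where
  adj X := .ofIsLeftAdjoint (F.obj X)
  unit_whiskerRight_map f := by
    ext X
    exact (unit_conjugateEquiv (.ofIsLeftAdjoint _) (.ofIsLeftAdjoint _) (F.map f) X).symm

lemma exists_hasLiftingProperty_iff [HasPullbacks C₂] {L R : C₂ ⥤ C₃}
    [L.IsLeftAdjoint] [R.IsLeftAdjoint] (α : L ⟶ R) {E B : C₃} (q : E ⟶ B) :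
    ∃ (U V : C₂) (p : U ⟶ V), ∀ ⦃X Y : C₂⦄ (i : X ⟶ Y) ⦃P : C₃⦄ ⦃l : R.obj X ⟶ P⦄
      ⦃r : L.obj Y ⟶ P⦄ (_ : IsPushout (α.app X) (L.map i) l r) (d : P ⟶ R.obj Y),
      l ≫ d = R.map i → r ≫ d = α.app Y → (HasLiftingProperty d q ↔ HasLiftingProperty i p) := by
  let F := ComposableArrows.mk₁ α
  have (j : Fin 2) : (F.obj j).IsLeftAdjoint := by
    fin_cases j <;> assumption
  let φ : (0 : Fin 2) ⟶ 1 := homOfLE zero_le_one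
  let sq' := Functor.PullbackObjObj.ofHasPullback (rightAdjoints F) φ q
  refine ⟨_, _, sq'.π, fun X Y i P l r sq d hl hr ↦ ?_⟩
  let sq₁₂ : F.PushoutObjObj φ i :=
    { pt := P
      inl := l
      inr := r
      isPushout := sq
      ι := d
      inl_ι := hl
      inr_ι := hr }
  exact (parametrizedAdjunction F).hasLiftingProperty_iff sq₁₂ sq'
end

end

section

open MonoidalCategory CartesianMonoidalCategory

section

variable {T : SSet.{w} ⥤ SSet.{w}} (τ : T ⟶ 𝟭 SSet.{w})

/-- The map between mapping cylinders induced by a map of simplicial sets. -/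
noncomputable def cylinderFunctorMap {X Y : SSet.{w}} (φ : X ⟶ Y) :
    mappingCylinder (τ.app X) ⟶ mappingCylinder (τ.app Y) :=
  mappingCylinder.desc (T.map φ ▷ _ ≫ mappingCylinder.ofCylinder (τ.app Y))
    (φ ≫ mappingCylinder.inl (τ.app Y)) (by
      calc SSet.ι₁ ≫ T.map φ ▷ _ ≫ mappingCylinder.ofCylinder (τ.app Y)
          = T.map φ ≫ SSet.ι₁ ≫ mappingCylinder.ofCylinder (τ.app Y) := rfl
        _ = T.map φ ≫ τ.app Y ≫ mappingCylinder.inl (τ.app Y) :=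
            congrArg (T.map φ ≫ ·) (mappingCylinder.condition _)
        _ = _ := τ.naturality_assoc φ _)

lemma ofCylinder_cylinderFunctorMap {X Y : SSet.{w}} (φ : X ⟶ Y) :
    mappingCylinder.ofCylinder (τ.app X) ≫ cylinderFunctorMap τ φ =
      T.map φ ▷ _ ≫ mappingCylinder.ofCylinder (τ.app Y) :=
  mappingCylinder.ofCylinder_desc _ _ _ _

/-- The functorial mapping cylinder of a natural transformation to the identity. -/
noncomputable def cylinderFunctor : SSet.{w} ⥤ SSet.{w} where
  obj X := mappingCylinder (τ.app X)
  map φ := cylinderFunctorMap τ φ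
  map_id X := mappingCylinder.hom_ext _
    ((ofCylinder_cylinderFunctorMap τ (𝟙 X)).trans
      (by rw [CategoryTheory.Functor.map_id]; rfl)) rfl
  map_comp {X Y Z} φ ψ := mappingCylinder.hom_ext _
    ((ofCylinder_cylinderFunctorMap τ (φ ≫ ψ)).trans (by
      rw [CategoryTheory.Functor.map_comp]
      refine Eq.symm ?_
      exact (congrArg (· ≫ cylinderFunctorMap τ ψ) (ofCylinder_cylinderFunctorMap τ φ)).trans
        (congrArg (T.map φ ▷ _ ≫ ·) (ofCylinder_cylinderFunctorMap τ ψ)))) rfl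

lemma cylinderFunctor_map_inr {X Y : SSet.{w}} (φ : X ⟶ Y) {m : SimplexCategoryᵒᵖ}
    (a : (T.obj X).obj m) (s : {s : (Δ[1] : SSet.{w}).obj m // s ≠ constSimplex 1 m}) :
    ((cylinderFunctor τ).map φ).app m (Sum.inr (a, s)) = Sum.inr ((T.map φ).app m a, s) :=
  cylinderMk_of_ne _ _ s.2

/-- The inclusion in the functorial mapping cylinder. -/
noncomputable def toCylinderFunctor : T ⟶ cylinderFunctor τ where
  app X := mappingCylinder.inr (τ.app X)
  naturality _ _ φ := (congrArg (SSet.ι₀ ≫ ·) (ofCylinder_cylinderFunctorMap τ φ)).symm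

instance {J : Type w} [SmallCategory J] [PreservesColimitsOfShape J T] :
    PreservesColimitsOfShape J (cylinderFunctor τ) :=
  preservesColimitsOfShape_of_evaluation _ _ fun m ↦ by
    let F (i : Option {s : (Δ[1] : SSet.{w}).obj m // s ≠ constSimplex 1 m}) :
        SSet.{w} ⥤ Type w := i.elim ((evaluation _ _).obj m) (fun _ ↦ T ⋙ (evaluation _ _).obj m)
    have (i : Option {s : (Δ[1] : SSet.{w}).obj m // s ≠ constSimplex 1 m}) :
        PreservesColimitsOfShape J (F i) := by
      cases i
      · exact inferInstanceAs (PreservesColimitsOfShape J ((evaluation _ _).obj m))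
      · exact inferInstanceAs (PreservesColimitsOfShape J (T ⋙ (evaluation _ _).obj m))
    refine preservesColimitsOfShape_of_sigma F
      (Option.rec { app X := ↾Sum.inl, naturality _ _ _ := rfl }
        fun s ↦ { app X := ↾fun a ↦ Sum.inr (a, s)
                  naturality X Y φ := by
                    ext a
                    exact (cylinderFunctor_map_inr τ φ a s).symm }) fun X ↦ ⟨?_, ?_⟩
    · rintro ⟨_ | s, a⟩ ⟨_ | s', a'⟩ h
      · obtain rfl : a = a' := Sum.inl_injective h
        rfl
      · exact (Sum.inl_ne_inr h).elim
      · exact (Sum.inr_ne_inl h).elim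
      · have h' := Sum.inr_injective h
        obtain rfl : s = s' := congrArg Prod.snd h'
        obtain rfl : a = a' := congrArg Prod.fst h'
        rfl
    · rintro (x | ⟨a, s⟩)
      · exact ⟨⟨none, x⟩, rfl⟩
      · exact ⟨⟨some s, a⟩, rfl⟩

end

instance : (nerveSimplices.{w}).IsLeftAdjoint :=
  have : PreservesColimitsOfSize.{0, w} nerveSimplices.{w} :=
    preservesColimitsOfSize_of_univLE.{w, w} _
  Presheaf.isLeftAdjoint_of_preservesColimits.{w} nerveSimplices.{w}

instance : (cylinderFunctor lastVertexMap.{w}).IsLeftAdjoint := by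
  have : PreservesColimitsOfSize.{w, w} (cylinderFunctor lastVertexMap.{w}) := ⟨inferInstance⟩
  have : PreservesColimitsOfSize.{0, w} (cylinderFunctor lastVertexMap.{w}) :=
    preservesColimitsOfSize_of_univLE.{w, w} _
  exact Presheaf.isLeftAdjoint_of_preservesColimits.{w} _

end

section

open MonoidalCategory CartesianMonoidalCategory

/-- The vertex of a nerve given by an object. -/
def nerveVertex {E : Type u} [Category.{v} E] (e : E) : (Δ[0] : SSet.{max u v}) ⟶ nerve E where
  app _ := ↾fun _ ↦ (Functor.const _).obj e
  naturality _ _ _ := rfl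

/-- The endpoints of the interval. -/
def intervalVertex (i : Fin 2) : (Δ[0] : SSet.{w}) ⟶ Δ[1] :=
  SSet.stdSimplex.map (SimplexCategory.const ⦋0⦌ ⦋1⦌ i)

/-- The path in the cylinder of a simplicial set at a given vertex. -/
def cylinderPath {Z : SSet.{w}} (e : Δ[0] ⟶ Z) : Δ[1] ⟶ Z ⊗ Δ[1] :=
  lift (SSet.stdSimplex.isTerminalObj₀.from _ ≫ e) (𝟙 _)

lemma intervalVertex_zero_cylinderPath {Z : SSet.{w}} (e : Δ[0] ⟶ Z) :
    intervalVertex 0 ≫ cylinderPath e = e ≫ SSet.ι₀ :=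
  CartesianMonoidalCategory.hom_ext _ _
    (congrArg (· ≫ e) (SSet.stdSimplex.isTerminalObj₀.hom_ext
      (intervalVertex 0 ≫ SSet.stdSimplex.isTerminalObj₀.from _) (𝟙 _))) rfl

lemma intervalVertex_one_cylinderPath {Z : SSet.{w}} (e : Δ[0] ⟶ Z) :
    intervalVertex 1 ≫ cylinderPath e = e ≫ SSet.ι₁ :=
  CartesianMonoidalCategory.hom_ext _ _
    (congrArg (· ≫ e) (SSet.stdSimplex.isTerminalObj₀.hom_ext
      (intervalVertex 1 ≫ SSet.stdSimplex.isTerminalObj₀.from _) (𝟙 _))) rfl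

lemma trivCof.of_path {Z : SSet.{w}} (γ : Δ[1] ⟶ Z) (ρ : Z ⟶ Δ[1]) (hρ : γ ≫ ρ = 𝟙 _) (i j : Fin 2)
    (h : trivCof (intervalVertex i ≫ γ)) : trivCof (intervalVertex j ≫ γ) := by
  have hk (k : Fin 2) : trivCof (intervalVertex.{w} k) :=
    anodyneExtensions_le_trivCof _ (anodyneExtensions_δ₀ k)
  have : Mono γ := (SplitMono.mk ρ hρ).mono
  exact MorphismProperty.comp_mem _ _ _ (hk j) (.of_precomp (hk i) h)

lemma trivCof.of_contraction {Z : SSet.{w}} {e : Δ[0] ⟶ Z} (H₁ H₂ : Z ⊗ Δ[1] ⟶ Z)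
    (h₁ : SSet.ι₀ ≫ H₁ = 𝟙 Z) (h : SSet.ι₁ ≫ H₁ = SSet.ι₁ ≫ H₂)
    (h₂ : SSet.ι₀ ≫ H₂ = SSet.stdSimplex.isTerminalObj₀.from Z ≫ e) : trivCof e := by
  let t := SSet.stdSimplex.isTerminalObj₀.from Z
  have sq := IsPushout.of_hasPushout SSet.ι₀ t
  let M := pushout SSet.ι₀ t
  let k : Z ⊗ Δ[1] ⟶ M := pushout.inl _ _
  let apex : Δ[0] ⟶ M := pushout.inr _ _
  have hapex : trivCof apex := MorphismProperty.of_isPushout (P := trivCof) sq.flip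
    (anodyneExtensions_le_trivCof _ (anodyneExtensions_ι₀ Z))
  let ρ : M ⟶ Δ[1] := sq.desc (snd _ _) (intervalVertex 0) rfl
  have sq' := IsPushout.of_hasPushout SSet.ι₁ (SSet.ι₁ ≫ k)
  let N := pushout SSet.ι₁ (SSet.ι₁ ≫ k)
  let l : Z ⊗ Δ[1] ⟶ N := pushout.inl _ _
  let r : M ⟶ N := pushout.inr _ _
  have hr : trivCof r := MorphismProperty.of_isPushout (P := trivCof) sq'.flip
    (anodyneExtensions_le_trivCof _ (anodyneExtensions_ι₁ Z))
  let ρ' : N ⟶ Δ[1] := sq'.desc (snd _ _) (constVertex M 1) rfl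
  have e₁ : trivCof (intervalVertex 1 ≫ cylinderPath e ≫ k) := by
    refine .of_path (cylinderPath e ≫ k) ρ ?_ 0 1 ?_
    · exact congrArg (cylinderPath e ≫ ·) (sq.inl_desc _ _ _)
    · have : intervalVertex 0 ≫ cylinderPath e ≫ k = apex := by
        calc intervalVertex 0 ≫ cylinderPath e ≫ k = e ≫ SSet.ι₀ ≫ k :=
              congrArg (· ≫ k) (intervalVertex_zero_cylinderPath e)
          _ = e ≫ t ≫ apex := congrArg (e ≫ ·) sq.w
          _ = apex := congrArg (· ≫ apex) (SSet.stdSimplex.isTerminalObj₀.hom_ext (e ≫ t) (𝟙 _))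
      rwa [this]
  have e₂ : trivCof (intervalVertex 0 ≫ cylinderPath e ≫ l) := by
    refine .of_path (cylinderPath e ≫ l) ρ' ?_ 1 0 ?_
    · exact congrArg (cylinderPath e ≫ ·) (sq'.inl_desc _ _ _)
    · have : intervalVertex 1 ≫ cylinderPath e ≫ l =
          (intervalVertex 1 ≫ cylinderPath e ≫ k) ≫ r := by
        calc intervalVertex 1 ≫ cylinderPath e ≫ l = e ≫ SSet.ι₁ ≫ l :=
              congrArg (· ≫ l) (intervalVertex_one_cylinderPath e)
          _ = e ≫ SSet.ι₁ ≫ k ≫ r := congrArg (e ≫ ·) sq'.w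
          _ = _ := congrArg (· ≫ k ≫ r) (intervalVertex_one_cylinderPath e).symm
      rw [this]
      exact MorphismProperty.comp_mem _ _ _ e₁ hr
  let s : N ⟶ Z := sq'.desc H₁ (sq.desc H₂ e h₂)
    (h.trans (congrArg (SSet.ι₁ ≫ ·) (sq.inl_desc H₂ e h₂).symm))
  have hs : (SSet.ι₀ ≫ l) ≫ s = 𝟙 Z := (congrArg (SSet.ι₀ ≫ ·) (sq'.inl_desc _ _ _)).trans h₁
  have he : intervalVertex 0 ≫ cylinderPath e ≫ l = e ≫ SSet.ι₀ ≫ l :=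
    congrArg (· ≫ l) (intervalVertex_zero_cylinderPath e)
  rw [he] at e₂
  have hre : RetractArrow e (e ≫ SSet.ι₀ ≫ l) :=
    { i := Arrow.homMk (𝟙 _) (SSet.ι₀ ≫ l) (Category.id_comp _)
      r := Arrow.homMk (𝟙 _) s ((Category.id_comp _).trans
        ((congrArg (e ≫ ·) hs).symm))
      retract := Arrow.hom_ext _ _ (Category.id_comp _) hs }
  exact MorphismProperty.of_retract hre e₂

lemma trivCof_nerveVertex {E : Type u} [Category.{v} E] (e : E) (c : E ⥤ E) (α : 𝟭 E ⟶ c)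
    (β : (Functor.const E).obj e ⟶ c) : trivCof (nerveVertex e) := by
  refine .of_contraction (nerveHomotopy α) (nerveHomotopy β) (ι₀_nerveHomotopy α) ?_
    (ι₀_nerveHomotopy β)
  exact (ι₁_nerveHomotopy α).trans (ι₁_nerveHomotopy β).symm

end

section

open MonoidalCategory CartesianMonoidalCategory

namespace Simplices

/-- The map obtained by adding a smallest element. -/
def consOrderHom {d n : ℕ} (s : Fin (d + 1) →o Fin (n + 1)) : Fin (d + 1 + 1) →o Fin (n + 1) where
  toFun := Fin.cons 0 s
  monotone' i j h := by
    induction i using Fin.cases with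
    | zero => exact Fin.zero_le _
    | succ i =>
      induction j using Fin.cases with
      | zero => exact absurd h (by simp)
      | succ j => exact s.monotone (Fin.succ_le_succ_iff.mp h)

/-- The order embedding obtained by adding a smallest element. -/
def consOrderEmbedding {d n : ℕ} (s : Fin (d + 1) ↪o Fin (n + 1)) :
    Fin (d + 1 + 1) ↪o Fin (n + 1 + 1) :=
  OrderEmbedding.ofStrictMono (Fin.cons 0 (Fin.succ ∘ s)) fun i j h ↦ by
    induction j using Fin.cases with
    | zero => exact absurd h (by simp)
    | succ j =>
      induction i using Fin.cases with
      | zero => exact Fin.succ_pos _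
      | succ i => exact Fin.succ_lt_succ_iff.mpr (s.strictMono (Fin.succ_lt_succ_iff.mp h))

/-- The simplex of the standard simplex obtained by adding the initial vertex. -/
def consSimplex {n : ℕ} (p : Simplices (Δ[n] : SSet.{w})) : Simplices (Δ[n] : SSet.{w}) where
  dim := ⦋p.dim.len + 1⦌ₛ
  simplex := SSet.stdSimplex.objEquiv.symm
    (SimplexCategory.Hom.mk (consOrderHom (SSet.stdSimplex.asOrderHom p.simplex)))

lemma Hom.asOrderHom {n : ℕ} {p q : Simplices (Δ[n] : SSet.{w})} (φ : p ⟶ q)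
    (k : Fin (p.dim.len + 1)) :
    SSet.stdSimplex.asOrderHom q.simplex (SemiSimplexCategory.homEquiv φ.face k) =
      SSet.stdSimplex.asOrderHom p.simplex k :=
  congrArg (fun s ↦ SSet.stdSimplex.asOrderHom s k) φ.map_simplex

lemma hom_ext_apply {X : SSet.{w}} {p q : Simplices X} {φ ψ : p ⟶ q}
    (h : ∀ k : Fin (p.dim.len + 1), SemiSimplexCategory.homEquiv (Hom.face φ) k =
      SemiSimplexCategory.homEquiv (Hom.face ψ) k) : φ = ψ :=
  Hom.ext (SemiSimplexCategory.hom_ext (RelEmbedding.ext h))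

lemma face_comp_apply {X : SSet.{w}} {p q r : Simplices X} (φ : p ⟶ q) (ψ : q ⟶ r)
    (k : Fin (p.dim.len + 1)) : SemiSimplexCategory.homEquiv (Hom.face (φ ≫ ψ)) k =
      SemiSimplexCategory.homEquiv (Hom.face ψ) (SemiSimplexCategory.homEquiv (Hom.face φ) k) :=
  homEquiv_comp_apply _ _ _

/-- Adding the initial vertex to simplices of the standard simplex. -/
def consFunctor (n : ℕ) : Simplices (Δ[n] : SSet.{w}) ⥤ Simplices (Δ[n] : SSet.{w}) where
  obj := consSimplex
  map {p q} φ := ⟨SemiSimplexCategory.homEquiv.symm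
      (consOrderEmbedding (SemiSimplexCategory.homEquiv φ.face)), ext_asOrderHom fun k ↦ by
    induction k using Fin.cases with
    | zero => rfl
    | succ k => exact Hom.asOrderHom φ k⟩
  map_id p := hom_ext_apply fun k ↦ by
    induction k using Fin.cases with
    | zero => rfl
    | succ k => rfl
  map_comp {p q r} φ ψ := hom_ext_apply fun k ↦ by
    refine Eq.trans ?_ (face_comp_apply _ _ _).symm
    induction k using Fin.cases with
    | zero => rfl
    | succ k => exact congrArg Fin.succ (face_comp_apply φ ψ k)

/-- The inclusion of a simplex in its cone. -/
def toConsSimplex {n : ℕ} (p : Simplices (Δ[n] : SSet.{w})) : p ⟶ consSimplex p :=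
  ⟨SemiSimplexCategory.homEquiv.symm (Fin.succOrderEmb _), ext_asOrderHom fun _ ↦ rfl⟩

/-- The initial vertex of the standard simplex. -/
def initialVertex (n : ℕ) : Simplices (Δ[n] : SSet.{w}) where
  dim := ⦋0⦌ₛ
  simplex := SSet.stdSimplex.objEquiv.symm (SimplexCategory.const ⦋0⦌ ⦋n⦌ 0)

/-- The inclusion of the initial vertex in the cone over a simplex. -/
def initialVertexToConsSimplex {n : ℕ} (p : Simplices (Δ[n] : SSet.{w})) :
    initialVertex n ⟶ consSimplex p :=
  ⟨SemiSimplexCategory.homEquiv.symm (OrderEmbedding.ofStrictMono (fun _ ↦ 0) fun i j h ↦ by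
      exact absurd h (by rw [(Subsingleton.elim (α := Fin 1) i j : i = j)]; exact lt_irrefl _)),
    ext_asOrderHom fun _ ↦ rfl⟩

/-- The map between cones over simplices. -/
def consMap {n : ℕ} {p q : Simplices (Δ[n] : SSet.{w})} (φ : p ⟶ q) :
    consSimplex p ⟶ consSimplex q := (consFunctor n).map φ

lemma toConsSimplex_naturality {n : ℕ} {p q : Simplices (Δ[n] : SSet.{w})} (φ : p ⟶ q) :
    φ ≫ toConsSimplex q = toConsSimplex p ≫ consMap φ :=
  hom_ext_apply fun k ↦ (face_comp_apply φ (toConsSimplex q) k).trans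
    (face_comp_apply (toConsSimplex p) (consMap φ) k).symm

lemma initialVertexToConsSimplex_naturality {n : ℕ} {p q : Simplices (Δ[n] : SSet.{w})}
    (φ : p ⟶ q) :
    initialVertexToConsSimplex q = initialVertexToConsSimplex p ≫ consMap φ :=
  hom_ext_apply fun k ↦ (face_comp_apply (initialVertexToConsSimplex p) (consMap φ) k).symm

end Simplices

open Simplices

lemma trivCof_initialVertex (n : ℕ) :
    trivCof (nerveVertex (initialVertex.{w} n)) :=
  trivCof_nerveVertex _ (consFunctor n)
    { app := toConsSimplex
      naturality _ _ φ := toConsSimplex_naturality φ }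
    { app := initialVertexToConsSimplex
      naturality _ _ φ := (Category.id_comp _).trans (initialVertexToConsSimplex_naturality φ) }

lemma trivCof_stdSimplex_vertex_zero (n : ℕ) :
    trivCof (SSet.stdSimplex.{w}.map (SimplexCategory.const ⦋0⦌ ⦋n⦌ 0)) := by
  have h : trivCof (nerveVertex (ULift.up.{w} (0 : Fin (n + 1)))) :=
    trivCof_nerveVertex _ (𝟭 _) (𝟙 _)
      { app j := homOfLE (Fin.zero_le j.down)
        naturality _ _ _ := rfl }
  have e : nerveVertex (ULift.up.{w} (0 : Fin (n + 1))) ≫ (SSet.stdSimplex.isoNerve n).inv =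
      SSet.stdSimplex.{w}.map (SimplexCategory.const ⦋0⦌ ⦋n⦌ 0) := by
    ext m s
    exact ext_asOrderHom fun k ↦ rfl
  rw [← e]
  exact MorphismProperty.RespectsRight.postcomp (Q := .isomorphisms _)
    (SSet.stdSimplex.isoNerve n).inv inferInstance _ h

lemma initialVertex_lastVertexMap (n : ℕ) :
    nerveVertex (initialVertex.{w} n) ≫ lastVertexMap.app Δ[n] =
      SSet.stdSimplex.{w}.map (SimplexCategory.const ⦋0⦌ ⦋n⦌ 0) := by
  ext m s
  exact ext_asOrderHom fun k ↦ rfl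

lemma trivCof_toCylinderFunctor_stdSimplex (n : ℕ) :
    trivCof ((toCylinderFunctor lastVertexMap.{w}).app Δ[n]) := by
  let f := lastVertexMap.{w}.app Δ[n]
  let e := nerveVertex (initialVertex.{w} n)
  let γ := cylinderPath e ≫ mappingCylinder.ofCylinder f
  have hγ : γ ≫ mappingCylinder.toInterval f = 𝟙 _ := 
    congrArg (cylinderPath e ≫ ·) (mappingCylinder.ofCylinder_toInterval f)
  have h₁ : trivCof (intervalVertex 1 ≫ γ) := by
    have : intervalVertex 1 ≫ γ =
        SSet.stdSimplex.{w}.map (SimplexCategory.const ⦋0⦌ ⦋n⦌ 0) ≫ mappingCylinder.inl f := by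
      calc intervalVertex 1 ≫ γ = e ≫ SSet.ι₁ ≫ mappingCylinder.ofCylinder f :=
            congrArg (· ≫ mappingCylinder.ofCylinder f) (intervalVertex_one_cylinderPath e)
        _ = e ≫ f ≫ mappingCylinder.inl f := congrArg (e ≫ ·) (mappingCylinder.condition f)
        _ = _ := congrArg (· ≫ mappingCylinder.inl f) (initialVertex_lastVertexMap n)
    rw [this]
    exact MorphismProperty.comp_mem _ _ _ (trivCof_stdSimplex_vertex_zero n)
      (mappingCylinder.trivCof_inl f)
  have h₀ := trivCof.of_path γ _ hγ 1 0 h₁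
  have : intervalVertex 0 ≫ γ = e ≫ mappingCylinder.inr f :=
    congrArg (· ≫ mappingCylinder.ofCylinder f) (intervalVertex_zero_cylinderPath e)
  rw [this] at h₀
  exact trivCof.of_precomp (g := mappingCylinder.inr f) (trivCof_initialVertex n) h₀

end

section

open HomotopicalAlgebra MonoidalCategory CartesianMonoidalCategory

lemma functor_comp_injective {A B E : Type*} [Category* A] [Category* B] [Category* E]
    (F : B ⥤ E) [F.Faithful] (hF : Function.Injective F.obj) {G G' : A ⥤ B}
    (h : G ⋙ F = G' ⋙ F) : G = G' := by
  refine CategoryTheory.Functor.ext (fun a ↦ hF (Functor.congr_obj h a)) fun a b f ↦ F.map_injective ?_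
  have := Functor.congr_hom h f
  simpa [eqToHom_map] using this

lemma Simplices.map_obj_injective {X Y : SSet.{w}} (f : X ⟶ Y) [Mono f] :
    Function.Injective (Simplices.map f).obj := by
  rintro ⟨d, s⟩ ⟨d', s'⟩ h
  obtain rfl : d = d' := congrArg Simplices.dim h
  have h' : f.app _ s = f.app _ s' := eq_of_heq (Simplices.mk.inj h).2
  have : Function.Injective (f.app (.op (SemiSimplexCategory.toSimplexCategory.obj d))) :=
    (mono_iff_injective _).1 inferInstance
  rw [this h']

instance {X Y : SSet.{w}} (f : X ⟶ Y) : (Simplices.map f).Faithful where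
  map_injective {p q} _ _ h := Simplices.Hom.ext
    (congrArg (Simplices.Hom.face (p := (Simplices.map f).obj p) (q := (Simplices.map f).obj q)) h)

instance {X Y : SSet.{w}} (f : X ⟶ Y) [Mono f] : Mono (nerveSimplices.map f) :=
  (NatTrans.mono_iff_mono_app _).2 fun _ ↦ (mono_iff_injective _).2 fun _ _ h ↦
    functor_comp_injective _ (Simplices.map_obj_injective f) h

lemma injective_app {X Y : SSet.{w}} (f : X ⟶ Y) [Mono f] (m : SimplexCategoryᵒᵖ) :
    Function.Injective (f.app m) :=
  (mono_iff_injective _).1 inferInstance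

instance {X Y : SSet.{w}} (f : X ⟶ Y) [Mono f] :
    Mono ((cylinderFunctor lastVertexMap).map f) :=
  (NatTrans.mono_iff_mono_app _).2 fun m ↦ (mono_iff_injective _).2 fun a b h ↦ by
    obtain a | ⟨a, s⟩ := a <;> obtain b | ⟨b, t⟩ := b
    · exact congrArg Sum.inl (injective_app f m (Sum.inl_injective h))
    · have := h.trans (cylinderFunctor_map_inr _ f b t)
      exact absurd this Sum.inl_ne_inr
    · have := (cylinderFunctor_map_inr _ f a s).symm.trans h
      exact absurd this Sum.inr_ne_inl
    · have := Sum.inr_injective ((cylinderFunctor_map_inr _ f a s).symm.trans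
        (h.trans (cylinderFunctor_map_inr _ f b t)))
      have h₁ := injective_app (nerveSimplices.map f) m (congrArg Prod.fst this)
      exact congrArg Sum.inr (Prod.ext h₁ (Prod.mk.inj this).2)

lemma toCylinderFunctor_app_apply (X : SSet.{w}) {m : SimplexCategoryᵒᵖ}
    (a : (nerveSimplices.obj X).obj m) :
    ((toCylinderFunctor lastVertexMap).app X).app m a =
      Sum.inr (a, ⟨_, constSimplex_zero_ne_one m⟩) :=
  mappingCylinder.inr_apply _ _

instance (X : SSet.{w}) : Mono ((toCylinderFunctor lastVertexMap).app X) :=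
  inferInstanceAs (Mono (mappingCylinder.inr _))

lemma mono_corner {X Y P : SSet.{w}} (i : X ⟶ Y) [Mono i]
    {l : (cylinderFunctor lastVertexMap).obj X ⟶ P} {r : nerveSimplices.obj Y ⟶ P}
    (sq : IsPushout ((toCylinderFunctor lastVertexMap).app X) (nerveSimplices.map i) l r)
    (d : P ⟶ (cylinderFunctor lastVertexMap).obj Y)
    (hl : l ≫ d = (cylinderFunctor lastVertexMap).map i)
    (hr : r ≫ d = (toCylinderFunctor lastVertexMap).app Y) : Mono d := by
  refine (NatTrans.mono_iff_mono_app _).2 fun m ↦ ?_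
  have : Mono (((cylinderFunctor lastVertexMap).map i).app m) := inferInstance
  refine Types.mono_of_isPushout_of_isPullback (sq.map ((evaluation _ _).obj m))
    (r' := ((cylinderFunctor lastVertexMap).map i).app m)
    (b' := ((toCylinderFunctor lastVertexMap).app Y).app m) ?_ (NatTrans.congr_app hl m)
    (NatTrans.congr_app hr m) fun x y _ _ h ↦ injective_app _ m h
  refine (Types.isPullback_iff _ _ _ _).2
    ⟨NatTrans.congr_app ((toCylinderFunctor lastVertexMap).naturality i) m |>.symm,
      fun x y h ↦ injective_app ((toCylinderFunctor lastVertexMap).app X) m h.1, fun c t h ↦ ?_⟩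
  have h' := h.trans (toCylinderFunctor_app_apply Y t)
  obtain x | ⟨a, s⟩ := c
  · exact absurd h' Sum.inl_ne_inr
  · have := Sum.inr_injective ((cylinderFunctor_map_inr _ i a s).symm.trans h')
    exact ⟨a, (toCylinderFunctor_app_apply X a).trans
      (congrArg Sum.inr (Prod.ext rfl (congrArg Prod.snd this).symm)), congrArg Prod.fst this⟩

lemma exists_trivCof_corner_iff :
    ∃ S : MorphismProperty SSet.{w}, ∀ ⦃X Y P : SSet.{w}⦄ (i : X ⟶ Y)
      ⦃l : (cylinderFunctor lastVertexMap).obj X ⟶ P⦄ ⦃r : nerveSimplices.obj Y ⟶ P⦄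
      (_ : IsPushout ((toCylinderFunctor lastVertexMap).app X) (nerveSimplices.map i) l r)
      (d : P ⟶ (cylinderFunctor lastVertexMap).obj Y),
      l ≫ d = (cylinderFunctor lastVertexMap).map i →
      r ≫ d = (toCylinderFunctor lastVertexMap).app Y → (trivCof d ↔ S.llp i) := by
  choose U V p hp using fun (E B : SSet.{w}) (q : E ⟶ B) ↦
    exists_hasLiftingProperty_iff (toCylinderFunctor lastVertexMap.{w}) q
  refine ⟨.ofHoms fun t : {t : Σ (E B : SSet.{w}), E ⟶ B // restrictions t.2.2} ↦ p _ _ t.1.2.2,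
    fun X Y P i l r sq d hl hr ↦ ⟨fun h ↦ ?_, fun h E B q hq ↦ ?_⟩⟩
  · rintro _ _ _ ⟨t⟩
    exact (hp _ _ _ i sq d hl hr).1 (h _ t.2)
  · exact (hp E B q i sq d hl hr).2 (h _ ⟨(⟨⟨E, B, q⟩, hq⟩ :
      {t : Σ (E B : SSet.{w}), E ⟶ B // restrictions t.2.2})⟩)

lemma trivCof_toCylinderFunctor_iff {S : MorphismProperty SSet.{w}}
    (hS : ∀ ⦃X Y P : SSet.{w}⦄ (i : X ⟶ Y)
      ⦃l : (cylinderFunctor lastVertexMap).obj X ⟶ P⦄ ⦃r : nerveSimplices.obj Y ⟶ P⦄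
      (_ : IsPushout ((toCylinderFunctor lastVertexMap).app X) (nerveSimplices.map i) l r)
      (d : P ⟶ (cylinderFunctor lastVertexMap).obj Y),
      l ≫ d = (cylinderFunctor lastVertexMap).map i →
      r ≫ d = (toCylinderFunctor lastVertexMap).app Y → (trivCof d ↔ S.llp i))
    (Y : SSet.{w}) :
    trivCof ((toCylinderFunctor lastVertexMap).app Y) ↔
      S.llp (SSet.Subcomplex.ι (⊥ : SSet.Subcomplex Y)) := by
  have h := SSet.Subcomplex.isInitialBot (X := Y)
  have h₁ := h.isInitialObj nerveSimplices
  have h₂ := h.isInitialObj (cylinderFunctor lastVertexMap)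
  have : IsIso ((toCylinderFunctor lastVertexMap).app ((⊥ : SSet.Subcomplex Y) : SSet.{w})) :=
    isIso_of_isInitial h₁ h₂ _
  exact hS _ (l := h₂.to _) (r := 𝟙 _) (IsPushout.of_horiz_isIso ⟨h₁.hom_ext _ _⟩) _
    (h₂.hom_ext _ _) (Category.id_comp _)

lemma llp_of_cell {S : MorphismProperty SSet.{w}} {X Y : SSet.{w}} (i : X ⟶ Y) [Mono i]
    (h : ∀ d, Nonempty (SSet.relativeCellComplexOfMono.Cell i d) →
      S.llp (SSet.boundary.{w} d).ι) : S.llp i := by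
  intro E B q hq
  exact MorphismProperty.transfiniteCompositionsOfShape_pushouts_coproducts_le_llp_rlp.{w} S.llp ℕ i
    ⟨(SSet.relativeCellComplexOfMono i).transfiniteCompositionOfShape' fun s ↦ h _ ⟨s.k⟩⟩ _
    fun _ _ _ hj ↦ hj _ hq

lemma trivCof_toCylinderFunctor (X : SSet.{w}) :
    trivCof ((toCylinderFunctor lastVertexMap).app X) := by
  obtain ⟨S, hS⟩ := exists_trivCof_corner_iff.{w}
  have hb (n : ℕ) : S.llp (SSet.boundary.{w} n).ι := by
    induction n using Nat.strong_induction_on with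
    | _ n ih =>
      have h₁ : trivCof ((toCylinderFunctor lastVertexMap).app (SSet.boundary.{w} n)) := by
        refine (trivCof_toCylinderFunctor_iff hS _).2 (llp_of_cell _ fun d ⟨c⟩ ↦ ih d ?_)
        exact SSet.dim_lt_of_nonDegenerate _ ⟨_, c.nonDegenerate⟩ n
      let i := (SSet.boundary.{w} n).ι
      have sq := IsPushout.of_hasPushout ((toCylinderFunctor lastVertexMap).app _)
        (nerveSimplices.map i)
      let d := sq.desc _ _ ((toCylinderFunctor lastVertexMap).naturality i).symm
      have hl := sq.inl_desc _ _ ((toCylinderFunctor lastVertexMap).naturality i).symm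
      have hr := sq.inr_desc _ _ ((toCylinderFunctor lastVertexMap).naturality i).symm
      have := mono_corner i sq d hl hr
      refine (hS i sq d hl hr).1 ?_
      refine trivCof.of_precomp (MorphismProperty.of_isPushout (P := trivCof) sq.flip h₁) ?_
      exact hr ▸ trivCof_toCylinderFunctor_stdSimplex n
  exact (trivCof_toCylinderFunctor_iff hS _).2 (llp_of_cell _ fun d _ ↦ hb d)

lemma isWeakHomotopyEquiv_lastVertexMap (X : SSet.{w}) :
    IsWeakHomotopyEquiv (lastVertexMap.app X) := by
  let f := lastVertexMap.app X
  have h₀ : IsWeakHomotopyEquiv (mappingCylinder.inl f ≫ mappingCylinder.toTarget f) :=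
    IsWeakHomotopyEquiv.of_htpy_inverse (f := 𝟙 X) (g := 𝟙 X) (Htpy.refl _) (Htpy.refl _)
  have h₁ := IsWeakHomotopyEquiv.of_comp_left (mappingCylinder.trivCof_inl f).isWeakHomotopyEquiv h₀
  have h₂ := (trivCof_toCylinderFunctor X).isWeakHomotopyEquiv.comp h₁
  have h₃ : (toCylinderFunctor lastVertexMap).app X ≫ mappingCylinder.toTarget f = f :=
    mappingCylinder.inr_toTarget f
  rwa [h₃] at h₂

end

section

open HomotopicalAlgebra MonoidalCategory CartesianMonoidalCategory

namespace Simplices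

section

variable {B : Type u} [Category.{v} B]

/-- The chain of morphisms corresponding to a simplex of a nerve. -/
def arrows (p : Simplices (nerve B)) : ComposableArrows B p.dim.len := p.simplex

/-- The operator underlying a morphism in the category of simplices. -/
def faceMap {X : SSet.{w}} {p q : Simplices X} (φ : p ⟶ q) :
    Fin (p.dim.len + 1) ↪o Fin (q.dim.len + 1) :=
  SemiSimplexCategory.homEquiv (Hom.face φ)

lemma faceMap_comp {X : SSet.{w}} {p q r : Simplices X} (φ : p ⟶ q) (ψ : q ⟶ r)
    (k : Fin (p.dim.len + 1)) : faceMap (φ ≫ ψ) k = faceMap ψ (faceMap φ k) :=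
  homEquiv_comp_apply _ _ _

lemma arrows_eq {p q : Simplices (nerve B)} (φ : p ⟶ q) :
    p.arrows = (faceMap φ).monotone.functor ⋙ q.arrows :=
  (Hom.map_simplex φ).symm

lemma arrows_obj {p q : Simplices (nerve B)} (φ : p ⟶ q) (k : Fin (p.dim.len + 1)) :
    p.arrows.obj k = q.arrows.obj (faceMap φ k) :=
  Functor.congr_obj (arrows_eq φ) k

lemma arrows_map {p q : Simplices (nerve B)} (φ : p ⟶ q) {k l : Fin (p.dim.len + 1)} (h : k ≤ l) :
    p.arrows.map (homOfLE h) = eqToHom (arrows_obj φ k) ≫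
      q.arrows.map (homOfLE ((faceMap φ).monotone h)) ≫ eqToHom (arrows_obj φ l).symm :=
  Functor.congr_hom (arrows_eq φ) (homOfLE h)

/-- The map between last vertices. -/
def lastHom {p q : Simplices (nerve B)} (φ : p ⟶ q) :
    p.arrows.obj (Fin.last _) ⟶ q.arrows.obj (Fin.last _) :=
  eqToHom (arrows_obj φ _) ≫ q.arrows.map (homOfLE (Fin.le_last _))

lemma lastHom_comp {p q r : Simplices (nerve B)} (φ : p ⟶ q) (ψ : q ⟶ r) :
    lastHom φ = eqToHom ((arrows_obj φ _).trans (arrows_obj ψ _)) ≫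
      r.arrows.map (homOfLE ((faceMap ψ).monotone (Fin.le_last (faceMap φ (Fin.last _))))) ≫
      eqToHom (arrows_obj ψ _).symm := by
  rw [lastHom, arrows_map ψ, eqToHom_trans_assoc]

lemma eqToHom_map_homOfLE {n : ℕ} (c : ComposableArrows B n) {i j k : Fin (n + 1)} (h : i = j)
    (hj : j ≤ k) : eqToHom (congrArg c.obj h) ≫ c.map (homOfLE hj) =
      c.map (homOfLE (h.trans_le hj)) := by
  subst h
  simp

/-- The last vertex functor from the category of simplices of the nerve of a category. -/
def lastVertexFunctor (B : Type u) [Category.{v} B] : Simplices (nerve B) ⥤ B where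
  obj p := p.arrows.obj (Fin.last _)
  map φ := lastHom φ
  map_id p := by
    have : lastHom (𝟙 p) = 𝟙 _ ≫ p.arrows.map (𝟙 _) := rfl
    rw [this, CategoryTheory.Functor.map_id, Category.comp_id]
  map_comp {p q r} φ ψ := by
    rw [lastHom_comp φ ψ]
    simp only [lastHom, Category.assoc, eqToHom_trans_assoc, eqToHom_refl, Category.id_comp,
      ← Functor.map_comp]
    rw [← eqToHom_map_homOfLE r.arrows (faceMap_comp φ ψ (Fin.last _)) (Fin.le_last _),
      eqToHom_trans_assoc]
    rfl

end

section

variable {B : Type max u v} [Category.{v} B]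

/-- The category of simplices of the nerve, in a suitable universe. -/
abbrev Elements (B : Type max u v) [Category.{v} B] : Type max u v :=
  ULiftHom.{v} (Simplices (nerve B))

/-- The last vertex functor, on the lifted category of simplices. -/
def lastVertexFunctor' (B : Type max u v) [Category.{v} B] : Elements B ⥤ B :=
  ULiftHom.down ⋙ lastVertexFunctor B

/-- The nerve of a category is isomorphic to that of the lifted category. -/
def nerveULiftHomIso (A : Type max u v) [Category.{0} A] :
    nerve (ULiftHom.{v} A) ≅ nerve A where
  hom := { app m := ↾fun G ↦ (G ⋙ ULiftHom.down : ComposableArrows A m.unop.len)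
           naturality _ _ _ := rfl }
  inv := { app m := ↾fun G ↦ (G ⋙ ULiftHom.up : ComposableArrows (ULiftHom.{v} A) m.unop.len)
           naturality _ _ _ := rfl }

lemma nerveMap_lastVertexFunctor' (B : Type max u v) [Category.{v} B] :
    nerveMap (lastVertexFunctor' B) =
      (nerveULiftHomIso (Simplices (nerve B))).hom ≫ lastVertexMap.app (nerve B) := by
  ext m G
  let c : ComposableArrows (Simplices (nerve B)) m.unop.len :=
    (G ⋙ ULiftHom.down : ComposableArrows _ m.unop.len)
  let r := c.obj (Fin.last _)
  let ψ (k : Fin (m.unop.len + 1)) : c.obj k ⟶ r := c.map (homOfLE (Fin.le_last k))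
  have hψ {k l : Fin (m.unop.len + 1)} (f : k ⟶ l) : ψ k = c.map f ≫ ψ l :=
    c.map_comp f (homOfLE (Fin.le_last l))
  have hk {k l : Fin (m.unop.len + 1)} (f : k ⟶ l) :
      faceMap (ψ k) (Fin.last _) = faceMap (ψ l) (faceMap (c.map f) (Fin.last _)) := by
    rw [hψ f, faceMap_comp]
  have key {k l : Fin (m.unop.len + 1)} (f : k ⟶ l)
      (h : faceMap (ψ k) (Fin.last _) ≤ faceMap (ψ l) (Fin.last _)) :
      lastHom (c.map f) = eqToHom (arrows_obj (ψ k) _) ≫ r.arrows.map (homOfLE h) ≫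
        eqToHom (arrows_obj (ψ l) _).symm := by
    rw [lastHom_comp (c.map f) (ψ l), ← eqToHom_map_homOfLE r.arrows (hk f)
      ((faceMap (ψ l)).monotone (Fin.le_last (faceMap (c.map f) (Fin.last _)))),
      Category.assoc, eqToHom_trans_assoc]
  exact CategoryTheory.Functor.ext (fun k ↦ arrows_obj (ψ k) (Fin.last _))
    fun k l f ↦ key f _

lemma isWeakHomotopyEquiv_lastVertexFunctor' (B : Type max u v) [Category.{v} B] :
    IsWeakHomotopyEquiv (nerveMap (lastVertexFunctor' B)) := by
  rw [nerveMap_lastVertexFunctor']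
  refine IsWeakHomotopyEquiv.comp (.of_htpy_inverse (g := (nerveULiftHomIso _).inv) ?_ ?_)
    (isWeakHomotopyEquiv_lastVertexMap _)
  · rw [Iso.hom_inv_id]; exact Htpy.refl _
  · rw [Iso.inv_hom_id]; exact Htpy.refl _

end

end Simplices

end

section

open HomotopicalAlgebra MonoidalCategory CartesianMonoidalCategory

lemma opIso_inv_inv {n : ℕ} {d : SimplexCategoryᵒᵖ} (z : (Δ[n] : SSet.{w}).obj d) :
    SSet.opObjEquiv ((SSet.stdSimplex.opIso ⦋n⦌).inv.app d
      (SSet.opObjEquiv ((SSet.stdSimplex.opIso ⦋n⦌).inv.app d z))) = z := by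
  obtain ⟨d⟩ := d
  induction d using SimplexCategory.rec with | _ d
  refine SSet.stdSimplex.ext _ _ fun i ↦ ?_
  rw [SSet.stdSimplex.opIso_inv_app_hom_apply, SSet.stdSimplex.opIso_inv_app_hom_apply]
  rw [SSet.stdSimplex.opObjEquiv_opObjEquiv_symm_apply,
    SSet.stdSimplex.opObjEquiv_opObjEquiv_symm_apply, Fin.rev_rev, Fin.rev_rev]

lemma opIso_inv_mem_horn {n : ℕ} {i : Fin (n + 1)} {d : SimplexCategoryᵒᵖ}
    {z : (Δ[n] : SSet.{w}).obj d} (hz : z ∈ (Λ[n, i.rev] : SSet.Subcomplex _).obj d) :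
    SSet.opObjEquiv ((SSet.stdSimplex.opIso ⦋n⦌).inv.app d z) ∈
      (Λ[n, i] : SSet.Subcomplex _).obj d := by
  rw [← SSet.op_horn] at hz
  exact hz

lemma opIso_inv_map {n : ℕ} {d d' : SimplexCategoryᵒᵖ} (f : d ⟶ d') (z : (Δ[n] : SSet.{w}).obj d) :
    SSet.opObjEquiv ((SSet.stdSimplex.opIso ⦋n⦌).inv.app d' ((Δ[n] : SSet.{w}).map f z)) =
      (Δ[n] : SSet.{w}).map (SimplexCategory.rev.map f.unop).op
        (SSet.opObjEquiv ((SSet.stdSimplex.opIso ⦋n⦌).inv.app d z)) := by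
  rw [NatTrans.naturality_apply (SSet.stdSimplex.opIso ⦋n⦌).inv f z, SSet.op_map]
  rfl

/-- The comparison of the opposite of a horn with a horn. -/
def hornOpHom {n : ℕ} (i : Fin (n + 1)) : (Λ[n, i.rev] : SSet.{w}) ⟶ (Λ[n, i] : SSet.{w}).op where
  app d := ↾fun z ↦ SSet.opObjEquiv.symm
    ⟨SSet.opObjEquiv ((SSet.stdSimplex.opIso ⦋n⦌).inv.app d z.1), opIso_inv_mem_horn z.2⟩
  naturality d d' f := by
    ext z
    exact Subtype.ext (opIso_inv_map f z.1)

lemma hornOpHom_apply {n : ℕ} {i : Fin (n + 1)} {d : SimplexCategoryᵒᵖ}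
    (z : (Λ[n, i] : SSet.{w}).obj d)
    (hz : SSet.opObjEquiv ((SSet.stdSimplex.opIso ⦋n⦌).inv.app d z.1) ∈
        (Λ[n, i.rev] : SSet.Subcomplex _).obj d) :
    SSet.opObjEquiv ((hornOpHom i).app d ⟨_, hz⟩) = z :=
  Subtype.ext (opIso_inv_inv z.1)

lemma KanComplex.op {K : SSet.{w}} (hK : KanComplex K) : KanComplex K.op where
  hornFilling n i σ₀ := by
    obtain ⟨t, ht⟩ := hK.hornFilling (hornOpHom i ≫
      SSet.opFunctor.map σ₀ ≫ SSet.opFunctorCompOpFunctorIso.hom.app K)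
    refine ⟨(SSet.stdSimplex.opIso ⦋n⦌).inv ≫ SSet.opFunctor.map t, ?_⟩
    ext d z
    have hz : SSet.opObjEquiv ((SSet.stdSimplex.opIso ⦋n⦌).inv.app d z.1) ∈
        (Λ[n, i.rev] : SSet.Subcomplex _).obj d :=
      opIso_inv_mem_horn (by rw [Fin.rev_rev]; exact z.2)
    have h₁ : SSet.opObjEquiv (σ₀.app d (SSet.opObjEquiv ((hornOpHom i).app d ⟨_, hz⟩))) =
        t.app d (SSet.opObjEquiv ((SSet.stdSimplex.opIso ⦋n⦌).inv.app d z.1)) :=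
      NatTrans.congr_app ht d |> fun h ↦ ConcreteCategory.congr_hom h _
    rw [hornOpHom_apply] at h₁
    exact h₁

lemma SHomotopy.op {X Y : SSet.{w}} {f g : X ⟶ Y} (h : SHomotopy f g) :
    SHomotopy (SSet.opFunctor.map g) (SSet.opFunctor.map f) := by
  obtain ⟨H, rfl, rfl⟩ := h.exists_tensor
  refine .of_tensor ((X.op ◁ (SSet.stdSimplex.opIso ⦋1⦌).inv) ≫
    Functor.LaxMonoidal.μ SSet.opFunctor _ _ ≫ SSet.opFunctor.map H) ?_ ?_
  · ext d x
    refine congrArg (H.app d) (Prod.ext rfl ?_)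
    obtain ⟨d⟩ := d
    induction d using SimplexCategory.rec with | _ d
    refine SSet.stdSimplex.ext _ _ fun i ↦ ?_
    rfl
  · ext d x
    refine congrArg (H.app d) (Prod.ext rfl ?_)
    obtain ⟨d⟩ := d
    induction d using SimplexCategory.rec with | _ d
    refine SSet.stdSimplex.ext _ _ fun i ↦ ?_
    rfl

lemma Htpy.op {X Y : SSet.{w}} {f g : X ⟶ Y} (h : Htpy f g) :
    Htpy (SSet.opFunctor.map f) (SSet.opFunctor.map g) := by
  induction h with
  | rel f g h => exact h.op.htpy.symm
  | refl f => exact .refl _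
  | symm f g _ h => exact h.symm
  | trans f g k _ _ h h' => exact h.trans h'

/-- The bijection between maps `X.op ⟶ Y` and maps `X ⟶ Y.op`. -/
def opTranspose {X Y : SSet.{w}} (f : X.op ⟶ Y) : X ⟶ Y.op :=
  SSet.opFunctorCompOpFunctorIso.inv.app X ≫ SSet.opFunctor.map f

lemma Htpy.opTranspose {X Y : SSet.{w}} {f g : X.op ⟶ Y} (h : Htpy f g) :
    Htpy (opTranspose f) (opTranspose g) := h.op.precomp _

/-- The inverse of `opTranspose`. -/
def opUntranspose {X Y : SSet.{w}} (f : X ⟶ Y.op) : X.op ⟶ Y :=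
  SSet.opFunctor.map f ≫ SSet.opFunctorCompOpFunctorIso.hom.app Y

lemma Htpy.opUntranspose {X Y : SSet.{w}} {f g : X ⟶ Y.op} (h : Htpy f g) :
    Htpy (opUntranspose f) (opUntranspose g) := h.op.postcomp _

lemma IsWeakHomotopyEquiv.op {X Y : SSet.{w}} {f : X ⟶ Y} (hf : IsWeakHomotopyEquiv f) :
    IsWeakHomotopyEquiv (SSet.opFunctor.map f) := by
  intro K hK
  obtain ⟨h₁, h₂⟩ := hf K.op hK.op
  refine ⟨fun g ↦ ?_, fun h h' H ↦ ?_⟩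
  · obtain ⟨h, hh⟩ := h₁ (opTranspose g)
    exact ⟨opUntranspose h, hh.opUntranspose⟩
  · exact (h₂ (opTranspose h) (opTranspose h') H.opTranspose).opUntranspose

/-- The functor reversing a finite linear order. -/
def revFunctor (n : ℕ) : Fin (n + 1) ⥤ (Fin (n + 1))ᵒᵖ where
  obj i := .op i.rev
  map f := (homOfLE (Fin.rev_le_rev.2 (leOfHom f))).op

lemma functor_ext_of_subsingleton {A : Type*} [Category* A] {B : Type*} [Category* B]
    [Quiver.IsThin B] {P Q : A ⥤ B} (h : ∀ a, P.obj a = Q.obj a) : P = Q :=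
  CategoryTheory.Functor.ext h fun _ _ _ ↦ Subsingleton.elim _ _

/-- Reversal of a chain of morphisms. -/
def reverseChain {C : Type u} [Category.{v} C] {n : ℕ} (G : Fin (n + 1) ⥤ C) :
    Fin (n + 1) ⥤ Cᵒᵖ := revFunctor n ⋙ G.op

lemma reverseChain_comp {C : Type u} [Category.{v} C] {n m : ℕ} (G : Fin (n + 1) ⥤ C)
    (P Q : Fin (m + 1) ⥤ Fin (n + 1)) (h : ∀ i, P.obj i.rev = (Q.obj i).rev) :
    reverseChain (P ⋙ G) = Q ⋙ reverseChain G :=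
  congrArg (fun R : Fin (m + 1) ⥤ (Fin (n + 1))ᵒᵖ ↦ R ⋙ G.op)
    (functor_ext_of_subsingleton (P := revFunctor m ⋙ P.op) (Q := Q ⋙ revFunctor n)
      fun i ↦ congrArg Opposite.op (h i))

lemma reverseChain_bijective {C : Type u} [Category.{v} C] (n : ℕ) :
    Function.Bijective (reverseChain (C := C) (n := n)) := by
  have h : (revFunctor n).leftOp ⋙ revFunctor n = 𝟭 _ :=
    functor_ext_of_subsingleton fun i ↦ congrArg Opposite.op (Fin.rev_rev i.unop)
  have h' : revFunctor n ⋙ (revFunctor n).leftOp = 𝟭 _ :=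
    functor_ext_of_subsingleton fun i ↦ Fin.rev_rev i
  refine Function.bijective_iff_has_inverse.2
    ⟨fun G ↦ ((revFunctor n).leftOp ⋙ G).unop, fun G ↦ ?_, fun G ↦ ?_⟩
  · exact congrArg (fun R : (Fin (n + 1))ᵒᵖ ⥤ (Fin (n + 1))ᵒᵖ ↦ (R ⋙ G.op).unop) h
  · exact congrArg (fun R : Fin (n + 1) ⥤ Fin (n + 1) ↦ R ⋙ G) h'

/-- The comparison of the nerve of the opposite category and of the opposite of the nerve. -/
def nerveOpHom (C : Type u) [Category.{v} C] : (nerve C).op ⟶ nerve Cᵒᵖ where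
  app m := ↾fun G ↦ (reverseChain (show Fin (m.unop.len + 1) ⥤ C from SSet.opObjEquiv G) :
      ComposableArrows Cᵒᵖ m.unop.len)
  naturality m m' f := by
    ext G
    refine reverseChain_comp (show Fin (m.unop.len + 1) ⥤ C from SSet.opObjEquiv G)
      (SimplexCategory.rev.map f.unop).toOrderHom.monotone.functor
      f.unop.toOrderHom.monotone.functor fun i ↦ ?_
    exact congrArg (fun j ↦ (f.unop.toOrderHom j).rev) (Fin.rev_rev i)

instance (C : Type u) [Category.{v} C] : IsIso (nerveOpHom C) := by
  have (m : SimplexCategoryᵒᵖ) : IsIso ((nerveOpHom C).app m) :=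
    (isIso_iff_bijective _).2 (reverseChain_bijective m.unop.len)
  exact NatIso.isIso_of_isIso_app _

lemma nerveOpHom_naturality {C : Type u} {D : Type u} [Category.{v} C] [Category.{v} D]
    (F : C ⥤ D) :
    nerveOpHom C ≫ nerveMap F.op = SSet.opFunctor.map (nerveMap F) ≫ nerveOpHom D := rfl

lemma IsWeakHomotopyEquiv.of_isIso {X Y : SSet.{w}} (f : X ⟶ Y) [IsIso f] :
    IsWeakHomotopyEquiv f :=
  .of_htpy_inverse (g := inv f) (by rw [IsIso.hom_inv_id]; exact .refl _)
    (by rw [IsIso.inv_hom_id]; exact .refl _)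

lemma IsWeakHomotopyEquiv.nerveMap_op {C : Type u} {D : Type u} [Category.{v} C] [Category.{v} D]
    {F : C ⥤ D} (hF : IsWeakHomotopyEquiv (nerveMap F)) : IsWeakHomotopyEquiv (nerveMap F.op) :=
  .of_comp_left (.of_isIso (nerveOpHom C)) (by
    rw [nerveOpHom_naturality]
    exact hF.op.comp (.of_isIso _))

end

section

open HomotopicalAlgebra MonoidalCategory CartesianMonoidalCategory

section

variable {E : Type*} [Category* E] {𝒲 : Type*} [Category* 𝒲]

/-- The objects of given degree over a given object. -/
structure Faces (deg : E → ℕ) (n : ℕ) (e : E) where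
  obj : E
  hom : obj ⟶ e
  deg_obj : deg obj = n

namespace Faces

variable {deg : E → ℕ} {n : ℕ} {e e' e'' : E}

lemma finite [Finite (Over e)] : Finite (Faces deg n e) :=
  Finite.of_injective (fun p : Faces deg n e ↦ Over.mk p.hom) (by
    rintro ⟨a, f, hf⟩ ⟨b, g, hg⟩ h
    have h₁ : a = b := congrArg (fun t : Over e ↦ t.left) h
    subst h₁
    have h₂ : f = g := by
      rw [← Over.mk_hom f, ← Over.mk_hom g]
      exact (Arrow.mk_inj _ _).1 (congrArg (fun t : Over e ↦ Arrow.mk t.hom) h)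
    subst h₂
    rfl)

/-- The functoriality of faces. -/
abbrev push (p : Faces deg n e) (φ : e ⟶ e') : Faces deg n e' := ⟨p.obj, p.hom ≫ φ, p.deg_obj⟩

variable [HasFiniteColimits 𝒲] [∀ e : E, Finite (Over e)]

instance (X : E → 𝒲) : HasCoproduct fun p : Faces deg n e ↦ X p.obj :=
  have := finite (deg := deg) (n := n) (e := e)
  inferInstance

variable (deg n) in
/-- The coproduct of a family of objects over the faces of given degree. -/
noncomputable def sum (X : E → 𝒲) (e : E) : 𝒲 := ∐ fun p : Faces deg n e ↦ X p.obj

/-- The inclusion of a summand. -/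
noncomputable def inc (X : E → 𝒲) (p : Faces deg n e) : X p.obj ⟶ sum deg n X e :=
  Limits.Sigma.ι (fun p : Faces deg n e ↦ X p.obj) p

/-- The map from the coproduct given by a family of maps. -/
noncomputable def desc {X : E → 𝒲} {Y : 𝒲} (f : ∀ p : Faces deg n e, X p.obj ⟶ Y) :
    sum deg n X e ⟶ Y := Limits.Sigma.desc f

lemma sum_hom_ext {X : E → 𝒲} {Y : 𝒲} {f g : sum deg n X e ⟶ Y}
    (h : ∀ p, inc X p ≫ f = inc X p ≫ g) : f = g := Limits.Sigma.hom_ext _ _ h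

lemma inc_desc {X : E → 𝒲} {Y : 𝒲} (f : ∀ p : Faces deg n e, X p.obj ⟶ Y) (p : Faces deg n e) :
    inc X p ≫ desc f = f p := Limits.Sigma.ι_desc _ _

variable (deg n e) in
/-- The map between coproducts induced by a family of maps. -/
noncomputable def sumMap {X Y : E → 𝒲} (f : ∀ e, X e ⟶ Y e) : sum deg n X e ⟶ sum deg n Y e :=
  Limits.Sigma.map fun p : Faces deg n e ↦ f p.obj

lemma llp_sumMap (T : MorphismProperty 𝒲) {X Y : E → 𝒲} (f : ∀ e, X e ⟶ Y e)
    (hf : ∀ e, T.llp (f e)) : T.llp (sumMap deg n e f) :=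
  MorphismProperty.colimMap (W := T.llp) _ fun p ↦ hf p.as.obj

lemma inc_sumMap {X Y : E → 𝒲} (f : ∀ e, X e ⟶ Y e) (p : Faces deg n e) :
    inc X p ≫ sumMap deg n e f = f p.obj ≫ inc Y p := Limits.Sigma.ι_map _ _

variable (deg n) in
/-- The functoriality of the coproduct over the faces. -/
noncomputable def sumPush (X : E → 𝒲) (φ : e ⟶ e') : sum deg n X e ⟶ sum deg n X e' :=
  desc fun p ↦ inc X (p.push φ)

lemma inc_sumPush (X : E → 𝒲) (p : Faces deg n e) (φ : e ⟶ e') :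
    inc X p ≫ sumPush deg n X φ = inc X (p.push φ) := inc_desc _ _

lemma inc_congr (X : E → 𝒲) {a : E} {f g : a ⟶ e} (h : f = g) (ha : deg a = n) :
    inc X (⟨a, f, ha⟩ : Faces deg n e) = inc X (⟨a, g, ha⟩ : Faces deg n e) := by
  subst h; rfl

lemma sumPush_id (X : E → 𝒲) : sumPush deg n X (𝟙 e) = 𝟙 _ :=
  sum_hom_ext fun p ↦ by
    rw [inc_sumPush, Category.comp_id]
    exact inc_congr X (Category.comp_id p.hom) p.deg_obj

lemma sumPush_comp (X : E → 𝒲) (φ : e ⟶ e') (ψ : e' ⟶ e'') :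
    sumPush deg n X (φ ≫ ψ) = sumPush deg n X φ ≫ sumPush deg n X ψ :=
  sum_hom_ext fun p ↦ by
    rw [inc_sumPush, ← Category.assoc, inc_sumPush]
    refine Eq.trans ?_ (inc_sumPush X (p.push φ) ψ).symm
    exact inc_congr X (Category.assoc p.hom φ ψ).symm p.deg_obj

lemma sumPush_sumMap {X Y : E → 𝒲} (f : ∀ e, X e ⟶ Y e) (φ : e ⟶ e') :
    sumPush deg n X φ ≫ sumMap deg n e' f = sumMap deg n e f ≫ sumPush deg n Y φ :=
  sum_hom_ext fun p ↦ by
    rw [← Category.assoc, inc_sumPush]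
    refine (inc_sumMap f (p.push φ)).trans ?_
    rw [← Category.assoc, inc_sumMap, Category.assoc, inc_sumPush]

variable (deg n e) in
/-- The map from the coproduct of the values of a functor on the faces. -/
noncomputable def sumDesc (F : E ⥤ 𝒲) : sum deg n F.obj e ⟶ F.obj e :=
  desc fun p ↦ F.map p.hom

lemma inc_sumDesc (F : E ⥤ 𝒲) (p : Faces deg n e) :
    inc F.obj p ≫ sumDesc deg n e F = F.map p.hom := inc_desc _ _

lemma sumPush_sumDesc (F : E ⥤ 𝒲) (φ : e ⟶ e') :
    sumPush deg n F.obj φ ≫ sumDesc deg n e' F = sumDesc deg n e F ≫ F.map φ :=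
  sum_hom_ext fun p ↦ by
    rw [← Category.assoc, inc_sumPush]
    refine (inc_sumDesc F (p.push φ)).trans ?_
    rw [← Category.assoc, inc_sumDesc, F.map_comp]

variable (deg n) in
/-- The coproduct over the faces of given degree, as a functor. -/
noncomputable def sumFunctor (X : E → 𝒲) : E ⥤ 𝒲 where
  obj e := sum deg n X e
  map φ := sumPush deg n X φ
  map_id _ := sumPush_id X
  map_comp φ ψ := sumPush_comp X φ ψ

variable (deg n) in
/-- The natural transformation between coproducts over faces. -/
noncomputable def sumFunctorMap {X Y : E → 𝒲} (f : ∀ e, X e ⟶ Y e) :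
    sumFunctor deg n X ⟶ sumFunctor deg n Y where
  app e := sumMap deg n e f
  naturality _ _ φ := sumPush_sumMap f φ

variable (deg n) in
/-- The natural transformation from the coproduct of the values of a functor on the faces. -/
noncomputable def sumFunctorDesc (F : E ⥤ 𝒲) : sumFunctor deg n F.obj ⟶ F where
  app e := sumDesc deg n e F
  naturality _ _ φ := sumPush_sumDesc F φ

/-- The trivial face. -/
abbrev self (deg : E → ℕ) (e : E) : Faces deg (deg e) e := ⟨e, 𝟙 e, rfl⟩

lemma isIso_inc_self (h : ∀ p : Faces deg (deg e) e, p = self deg e) (X : E → 𝒲) :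
    IsIso (inc X (self deg e)) := by
  have hX (p : Faces deg (deg e) e) : X p.obj = X e := by rw [h p]
  refine ⟨⟨desc fun p ↦ eqToHom (hX p), ?_, ?_⟩⟩
  · exact inc_desc _ _
  · refine sum_hom_ext fun p ↦ ?_
    rw [← Category.assoc, inc_desc, Category.comp_id]
    obtain rfl := h p
    exact Category.id_comp _

end Faces

open Faces

variable [HasFiniteColimits 𝒲] [∀ e : E, Finite (Over e)]

/-- The inductive step of the replacement of a functor on a direct category. -/
lemma exists_replacement_step {deg : E → ℕ}
    (hdeg : ∀ (e : E) (p : Faces deg (deg e) e), p = self deg e)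
    (T : MorphismProperty 𝒲) (V R : ObjectProperty 𝒲) [R.IsClosedUnderIsomorphisms]
    (hV : ∀ ⦃a b : 𝒲⦄ (f : a ⟶ b), T.llp f → V a → V b)
    (hR : ∀ a, V a → ∃ (b : 𝒲) (f : a ⟶ b), T.llp f ∧ R b)
    (n : ℕ) (F : E ⥤ 𝒲) (hF : ∀ e, V (F.obj e)) :
    ∃ (F' : E ⥤ 𝒲) (_ : F ⟶ F'), (∀ e, V (F'.obj e)) ∧ ∀ e, deg e = n → R (F'.obj e) := by
  choose X j hj hX using fun e ↦ hR _ (hF e)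
  let a := sumFunctorMap deg n j
  let b := sumFunctorDesc deg n F
  have sq (e : E) : IsPushout (a.app e) (b.app e) ((pushout.inl a b).app e)
      ((pushout.inr a b).app e) :=
    (IsPushout.of_hasPushout a b).map ((evaluation E 𝒲).obj e)
  refine ⟨pushout a b, pushout.inr _ _, fun e ↦ ?_, fun e he ↦ ?_⟩
  · exact hV _ (MorphismProperty.of_isPushout (P := T.llp) (sq e).flip (llp_sumMap T j hj)) (hF e)
  · subst he
    have h₁ := isIso_inc_self (hdeg e) F.obj
    have h₂ := isIso_inc_self (hdeg e) X
    have h₃ : IsIso (b.app e) :=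
      IsIso.of_isIso_fac_left (h := 𝟙 (F.obj e)) (f := inc F.obj (self deg e))
        ((inc_sumDesc F (self deg e)).trans (F.map_id e))
    have h₄ : IsIso ((pushout.inl a b).app e) := (sq e).isIso_inl_of_isIso
    exact R.prop_of_iso (asIso (inc X (self deg e)) ≪≫ @asIso _ _ _ _ _ h₄) (hX e)

/-- The replacement of a functor on a direct category. -/
lemma exists_replacement {deg : E → ℕ} (hle : ∀ ⦃e e' : E⦄ (_ : e ⟶ e'), deg e ≤ deg e')
    (hdeg : ∀ (e : E) (p : Faces deg (deg e) e), p = self deg e)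
    (T : MorphismProperty 𝒲) (V R : ObjectProperty 𝒲) [R.IsClosedUnderIsomorphisms]
    (hV : ∀ ⦃a b : 𝒲⦄ (f : a ⟶ b), T.llp f → V a → V b)
    (hR : ∀ a, V a → ∃ (b : 𝒲) (f : a ⟶ b), T.llp f ∧ R b)
    (F : E ⥤ 𝒲) (hF : ∀ e, V (F.obj e)) :
    ∃ (F' : E ⥤ 𝒲) (_ : F ⟶ F'), ∀ e, R (F'.obj e) := by
  choose next τ hnext hR' using fun (n : ℕ) (F : {F : E ⥤ 𝒲 // ∀ e, V (F.obj e)}) ↦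
    exists_replacement_step hdeg T V R hV hR n F.1 F.2
  let S (n : ℕ) : {F : E ⥤ 𝒲 // ∀ e, V (F.obj e)} :=
    Nat.rec ⟨F, hF⟩ (fun n F ↦ ⟨next n F, hnext n F⟩) n
  let Q : ℕ ⥤ E ⥤ 𝒲 := Functor.ofSequence (X := fun n ↦ (S n).1) fun n ↦ τ n (S n)
  have hQ (k l m : ℕ) (h : k ≤ l) (h' : l ≤ m) (e : E) :
      (Q.map (homOfLE h)).app e ≫ (Q.map (homOfLE h')).app e =
        (Q.map (homOfLE (h.trans h'))).app e := by
    rw [← NatTrans.comp_app, ← Q.map_comp]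
    rfl
  have hQ' (k l : ℕ) (h : k ≤ l) {e e' : E} (φ : e ⟶ e') :
      (Q.obj k).map φ ≫ (Q.map (homOfLE h)).app e' = (Q.map (homOfLE h)).app e ≫ (Q.obj l).map φ :=
    (Q.map (homOfLE h)).naturality φ
  have hs {e e' : E} (φ : e ⟶ e') : deg e + 1 ≤ deg e' + 1 := Nat.succ_le_succ (hle φ)
  let Φ : E ⥤ 𝒲 :=
    { obj e := (Q.obj (deg e + 1)).obj e
      map {e e'} φ := (Q.map (homOfLE (hs φ))).app e ≫ (Q.obj (deg e' + 1)).map φ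
      map_id e := by
        rw [CategoryTheory.Functor.map_id, Category.comp_id]
        exact congrArg (fun f ↦ NatTrans.app f e) (Q.map_id (deg e + 1))
      map_comp {e e' e''} φ ψ := by
        rw [Functor.map_comp, Category.assoc, ← Category.assoc ((Q.obj (deg e' + 1)).map φ),
          hQ' _ _ (hs ψ), Category.assoc]
        exact (congrArg (· ≫ _) (hQ _ _ _ (hs φ) (hs ψ) e).symm).trans (Category.assoc _ _ _) }
  refine ⟨Φ,
    { app e := (Q.map (homOfLE (Nat.zero_le (deg e + 1)))).app e
      naturality e e' φ := ?_ }, fun e ↦ hR' (deg e) (S (deg e)) e rfl⟩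
  have := hQ _ _ _ (Nat.zero_le (deg e + 1)) (hs φ) e
  exact (hQ' _ _ (Nat.zero_le (deg e' + 1)) φ).trans ((congrArg (· ≫ _) this.symm).trans
    (Category.assoc _ _ _))

end

end

section

open HomotopicalAlgebra MonoidalCategory CartesianMonoidalCategory

namespace Simplices

lemma mk_eq_of_range_eq {X : SSet.{w}} {p p' q : Simplices X} (φ : p ⟶ q) (φ' : p' ⟶ q)
    (h : Set.range (faceMap φ) = Set.range (faceMap φ')) : Over.mk φ = Over.mk φ' := by
  obtain ⟨⟨n⟩, x⟩ := p
  obtain ⟨⟨n'⟩, x'⟩ := p'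
  have hn : n = n' := by
    have h₁ := Set.card_range_of_injective (faceMap φ).injective
    have h₂ := Set.card_range_of_injective (faceMap φ').injective
    rw [← Nat.card_eq_fintype_card, ← Nat.card_eq_fintype_card] at h₁ h₂
    simp only [h] at h₁
    have := h₁.symm.trans h₂
    simp at this
    exact this
  subst hn
  have hf : Hom.face φ = Hom.face φ' := by
    apply SemiSimplexCategory.homEquiv.injective
    exact OrderEmbedding.range_inj.1 h
  have hx : x = x' := by
    have h₁ := Hom.map_simplex φ
    have h₂ := Hom.map_simplex φ'
    rw [hf] at h₁
    exact h₁.symm.trans h₂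
  subst hx
  obtain rfl : φ = φ' := Hom.ext hf
  rfl

instance {X : SSet.{w}} (q : Simplices X) : Finite (Over q) :=
  Finite.of_injective (fun p : Over q ↦ Set.range (faceMap p.hom)) fun p p' h ↦
    mk_eq_of_range_eq p.hom p'.hom h

lemma len_le {X : SSet.{w}} {p q : Simplices X} (φ : p ⟶ q) : p.dim.len ≤ q.dim.len := by
  have := Fintype.card_le_of_embedding (faceMap φ).toEmbedding
  simpa using this

lemma mk_eq_of_len_eq {X : SSet.{w}} {p q : Simplices X} (φ : p ⟶ q) (h : p.dim.len = q.dim.len) :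
    Over.mk φ = Over.mk (𝟙 q) := by
  refine mk_eq_of_range_eq φ (𝟙 q) ?_
  have h₁ : Function.Surjective (faceMap (𝟙 q)) := fun k ↦ ⟨k, rfl⟩
  have h₂ : Function.Bijective (faceMap φ) :=
    (Fintype.bijective_iff_injective_and_card _).2 ⟨(faceMap φ).injective, by simp [h]⟩
  rw [h₁.range_eq, h₂.2.range_eq]

end Simplices

open Simplices

section

variable {A : Type*} [Category* A]

lemma mk_eq_of_mk_down_eq {p p' q : ULiftHom.{w} A} (φ : p ⟶ q) (φ' : p' ⟶ q)
    (h : Over.mk (ULiftHom.down.map φ) = Over.mk (ULiftHom.down.map φ')) :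
    Over.mk φ = Over.mk φ' := by
  have h₁ : ULiftHom.down.obj p = ULiftHom.down.obj p' := congrArg (fun t ↦ t.left) h
  have h₁' : p = p' := h₁
  subst h₁'
  have h₂ : ULiftHom.down.map φ = ULiftHom.down.map φ' := by
    have := congrArg (fun t ↦ Arrow.mk t.hom) h
    exact (Arrow.mk_inj _ _).1 this
  obtain rfl : φ = φ' := ULift.down_injective h₂
  rfl

end

instance {B : Type max u v} [Category.{v} B] (e : Elements B) : Finite (Over e) :=
  Finite.of_injective (fun p : Over e ↦ Over.mk (ULiftHom.down.map p.hom)) fun p p' h ↦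
    mk_eq_of_mk_down_eq p.hom p'.hom h

namespace Elements

variable {B : Type max u v} [Category.{v} B]

/-- The degree of a simplex. -/
def deg (e : Elements B) : ℕ := (ULiftHom.down.obj e).dim.len

lemma deg_le {e e' : Elements B} (φ : e ⟶ e') : deg e ≤ deg e' :=
  len_le (ULiftHom.down.map φ)

lemma eq_self (e : Elements B) (p : Faces deg (deg e) e) : p = Faces.self deg e := by
  obtain ⟨a, f, h⟩ := p
  have h₁ : Over.mk f = Over.mk (𝟙 e) :=
    mk_eq_of_mk_down_eq f (𝟙 e) (mk_eq_of_len_eq (ULiftHom.down.map f) h)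
  have h₂ : a = e := congrArg (fun t : Over e ↦ t.left) h₁
  subst h₂
  obtain rfl : f = 𝟙 a := (Arrow.mk_inj _ _).1 (congrArg (fun t : Over a ↦ Arrow.mk t.hom) h₁)
  rfl

/-- The functor between categories of simplices induced by a functor. -/
def map {B B' : Type max u v} [Category.{v} B] [Category.{v} B'] (k : B ⥤ B') :
    Elements B ⥤ Elements B' :=
  ULiftHom.down ⋙ Simplices.map (nerveMap k) ⋙ ULiftHom.up

end Elements

lemma map_lastHom {B B' : Type max u v} [Category.{v} B] [Category.{v} B'] (k : B ⥤ B')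
    {p q : Simplices (nerve B)} (φ : p ⟶ q) :
    k.map (lastHom φ) = lastHom ((Simplices.map (nerveMap k)).map φ) := by
  have h : k.map (lastHom φ) = eqToHom (congrArg k.obj (arrows_obj φ (Fin.last _))) ≫
      k.map (q.arrows.map (homOfLE (Fin.le_last _))) := by
    rw [lastHom, CategoryTheory.Functor.map_comp, eqToHom_map]
  exact h

lemma map_lastVertexFunctor'_map {B B' : Type max u v} [Category.{v} B] [Category.{v} B']
    (k : B ⥤ B') {e e' : Elements B} (φ : e ⟶ e') :
    k.map ((lastVertexFunctor' B).map φ) =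
      (lastVertexFunctor' B').map ((Elements.map k).map φ) :=
  map_lastHom k (ULiftHom.down.map φ)

/-- The naturality of the last vertex functor. -/
def lastVertexFunctor'Comp {B B' : Type max u v} [Category.{v} B] [Category.{v} B'] (k : B ⥤ B') :
    lastVertexFunctor' B ⋙ k ⟶ Elements.map k ⋙ lastVertexFunctor' B' where
  app e := 𝟙 (k.obj ((lastVertexFunctor' B).obj e))
  naturality e e' φ :=
    (Category.comp_id _).trans ((map_lastVertexFunctor'_map k φ).trans (Category.id_comp _).symm)

theorem isWeakHomotopyEquiv_ιOfLE {𝒲 : Type max u v} [Category.{v} 𝒲] [HasFiniteColimits 𝒲]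
    (T : MorphismProperty 𝒲) (V R : ObjectProperty 𝒲) [R.IsClosedUnderIsomorphisms]
    (hRV : R ≤ V) (hV : ∀ ⦃a b : 𝒲⦄ (f : a ⟶ b), T.llp f → V a → V b)
    (hR : ∀ a, V a → ∃ (b : 𝒲) (f : a ⟶ b), T.llp f ∧ R b) :
    IsWeakHomotopyEquiv (nerveMap (ObjectProperty.ιOfLE hRV)) := by
  let k := ObjectProperty.ιOfLE hRV
  let lV := lastVertexFunctor' V.FullSubcategory
  let lR := lastVertexFunctor' R.FullSubcategory
  obtain ⟨Φ₀, τ, hΦ₀⟩ := exists_replacement (fun _ _ φ ↦ Elements.deg_le φ) Elements.eq_self T V R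
    hV hR (lV ⋙ V.ι) fun e ↦ (lV.obj e).property
  let Φ : Elements V.FullSubcategory ⥤ R.FullSubcategory := R.lift Φ₀ hΦ₀
  let α : lV ⟶ Φ ⋙ k :=
    { app e := ObjectProperty.homMk (τ.app e)
      naturality _ _ φ := by
        ext
        exact τ.naturality φ }
  let β : lR ⟶ Elements.map k ⋙ Φ :=
    { app e := ObjectProperty.homMk
        (((lastVertexFunctor'Comp k).app e).hom ≫ τ.app ((Elements.map k).obj e))
      naturality e e' φ := by
        ext
        have h₁ := congrArg (fun f ↦ f.hom) ((lastVertexFunctor'Comp k).naturality φ)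
        have h₂ := τ.naturality ((Elements.map k).map φ)
        refine (Category.assoc _ _ _).symm.trans ((congrArg (· ≫ _) h₁).trans ?_)
        exact (Category.assoc _ _ _).trans ((congrArg (_ ≫ ·) h₂).trans
          (Category.assoc _ _ _).symm) }
  have hα : IsWeakHomotopyEquiv (nerveMap Φ ≫ nerveMap k) :=
    .of_htpy (isWeakHomotopyEquiv_lastVertexFunctor' _) (htpy_nerveMap α)
  have hβ : IsWeakHomotopyEquiv (nerveMap (Elements.map k) ≫ nerveMap Φ) :=
    .of_htpy (isWeakHomotopyEquiv_lastVertexFunctor' _) (htpy_nerveMap β)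
  exact .two_of_six hβ hα

end

section

open HomotopicalAlgebra MonoidalCategory CartesianMonoidalCategory

namespace ModelStructure

variable {C : Type u} [Category.{v} C] (M : ModelStructure C)

lemma isRetractOf_of_lift {X Y Z : C} {f : X ⟶ Y} {i : X ⟶ Z} {p : Z ⟶ Y} (h : i ≫ p = f)
    [HasLiftingProperty f p] : IsRetractOf f i := by
  have sq : CommSq i f p (𝟙 Y) := ⟨by rw [h, Category.comp_id]⟩
  exact ⟨𝟙 X, 𝟙 X, sq.lift, p, Category.comp_id _, sq.fac_right,
    by rw [Category.id_comp, sq.fac_left], by rw [Category.id_comp, h]⟩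

lemma isRetractOf_of_lift' {X Y Z : C} {f : X ⟶ Y} {i : X ⟶ Z} {p : Z ⟶ Y} (h : i ≫ p = f)
    [HasLiftingProperty i f] : IsRetractOf f p := by
  have sq : CommSq (𝟙 X) i f p := ⟨by rw [h, Category.id_comp]⟩
  exact ⟨i, sq.lift, 𝟙 Y, 𝟙 Y, sq.fac_left, Category.comp_id _,
    by rw [h, Category.comp_id], by rw [sq.fac_right, Category.comp_id]⟩

lemma llp_fib_iff {X Y : C} (f : X ⟶ Y) : M.Fib.llp f ↔ M.Cof f ∧ M.W f := by
  refine ⟨fun hf ↦ ?_, fun hf _ _ p hp ↦ M.lifting_acof_fib f p hf.1 hf.2 hp⟩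
  obtain ⟨Z, i, p, hi, hi', hp, fac⟩ := M.fact_acof_fib f
  have := hf p hp
  exact ⟨M.Cof_retract (isRetractOf_of_lift fac) hi, M.W_retract (isRetractOf_of_lift fac) hi'⟩

lemma fib_of_rlp {X Y : C} (f : X ⟶ Y)
    (hf : ∀ ⦃A B : C⦄ (i : A ⟶ B), M.Cof i → M.W i → HasLiftingProperty i f) : M.Fib f := by
  obtain ⟨Z, i, p, hi, hi', hp, fac⟩ := M.fact_acof_fib f
  have := hf i hi hi'
  exact M.Fib_retract (isRetractOf_of_lift' fac) hp

lemma w_of_rlp {X Y : C} (f : X ⟶ Y)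
    (hf : ∀ ⦃A B : C⦄ (i : A ⟶ B), M.Cof i → HasLiftingProperty i f) : M.W f := by
  obtain ⟨Z, i, p, hi, hp, hp', fac⟩ := M.fact_cof_afib f
  have := hf i hi
  exact M.W_retract (isRetractOf_of_lift' fac) hp'

lemma acof_of_isIso {X Y : C} (f : X ⟶ Y) [IsIso f] : M.Cof f ∧ M.W f :=
  (M.llp_fib_iff f).1 fun _ _ _ _ ↦ inferInstance

lemma fib_of_isIso {X Y : C} (f : X ⟶ Y) [IsIso f] : M.Fib f :=
  M.fib_of_rlp f fun _ _ _ _ _ ↦ inferInstance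

lemma isRetractOf_unop {X Y X' Y' : Cᵒᵖ} {f : X ⟶ Y} {g : X' ⟶ Y'} (h : IsRetractOf f g) :
    IsRetractOf f.unop g.unop := by
  obtain ⟨i, r, j, s, h₁, h₂, h₃, h₄⟩ := h
  exact ⟨s.unop, j.unop, r.unop, i.unop, Quiver.Hom.op_inj h₂, Quiver.Hom.op_inj h₁,
    Quiver.Hom.op_inj h₄.symm, Quiver.Hom.op_inj h₃.symm⟩

/-- The opposite model structure. -/
def op : ModelStructure Cᵒᵖ where
  W := M.W.op
  Cof := M.Fib.op
  Fib := M.Cof.op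
  W_id X := M.W_id X.unop
  Cof_id X := M.Fib_id X.unop
  Fib_id X := M.Cof_id X.unop
  W_comp f g hf hg := M.W_comp g.unop f.unop hg hf
  Cof_comp f g hf hg := M.Fib_comp g.unop f.unop hg hf
  Fib_comp f g hf hg := M.Cof_comp g.unop f.unop hg hf
  W_of_precomp f g hf h := M.W_of_postcomp g.unop f.unop hf h
  W_of_postcomp f g hg h := M.W_of_precomp g.unop f.unop hg h
  W_retract h := M.W_retract (isRetractOf_unop h)
  Cof_retract h := M.Fib_retract (isRetractOf_unop h)
  Fib_retract h := M.Cof_retract (isRetractOf_unop h)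
  lifting_acof_fib i p hi hi' hp := by
    have := M.lifting_cof_afib p.unop i.unop hp hi hi'
    exact (HasLiftingProperty.iff_unop i p).2 this
  lifting_cof_afib i p hi hp hp' := by
    have := M.lifting_acof_fib p.unop i.unop hp hp' hi
    exact (HasLiftingProperty.iff_unop i p).2 this
  fact_acof_fib f := by
    obtain ⟨Z, i, p, hi, hp, hp', fac⟩ := M.fact_cof_afib f.unop
    exact ⟨.op Z, p.op, i.op, hp, hp', hi, Quiver.Hom.unop_inj fac⟩
  fact_cof_afib f := by
    obtain ⟨Z, i, p, hi, hi', hp, fac⟩ := M.fact_acof_fib f.unop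
    exact ⟨.op Z, p.op, i.op, hp, hi, hi', Quiver.Hom.unop_inj fac⟩

end ModelStructure

section

variable {C D : Type u} [Category.{v} C] [Category.{v} D]
  {MC : ModelStructure C} {MD : ModelStructure D} (Q : QuillenAdjunction MC MD)

lemma QuillenAdjunction.G_fib {X Y : D} (f : X ⟶ Y) (hf : MD.Fib f) : MC.Fib (Q.G.map f) :=
  MC.fib_of_rlp _ fun _ _ i hi hi' ↦ (Q.adj.hasLiftingProperty_iff i f).1
    (MD.lifting_acof_fib _ _ (Q.F_cof i hi) (Q.F_acof i hi hi') hf)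

lemma QuillenAdjunction.G_afib {X Y : D} (f : X ⟶ Y) (hf : MD.Fib f) (hf' : MD.W f) :
    MC.W (Q.G.map f) :=
  MC.w_of_rlp _ fun _ _ i hi ↦ (Q.adj.hasLiftingProperty_iff i f).1
    (MD.lifting_cof_afib _ _ (Q.F_cof i hi) hf hf')

/-- The opposite Quillen adjunction. -/
def QuillenAdjunction.op : QuillenAdjunction MD.op MC.op where
  F := Q.G.op
  G := Q.F.op
  adj := Q.adj.op
  F_cof f hf := Q.G_fib f.unop hf
  F_acof f hf hf' := Q.G_afib f.unop hf hf'

end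

section

variable {C : Type u} [Category.{v} C] (M : ModelStructure C)

lemma ModelStructure.cofibrant_iff [HasInitial C] {X I : C} (hI : IsInitial I) (i : I ⟶ X) :
    Cofibrant M X ↔ M.Cof i := by
  have h : initial.to X = (initialIsInitial.uniqueUpToIso hI).hom ≫ i :=
    initialIsInitial.hom_ext _ _
  have h' : i = (initialIsInitial.uniqueUpToIso hI).inv ≫ initial.to X := hI.hom_ext _ _
  refine ⟨fun hX ↦ ?_, fun hi ↦ ?_⟩
  · rw [h']
    exact M.Cof_comp _ _ (M.acof_of_isIso _).1 hX
  · rw [Cofibrant, h]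
    exact M.Cof_comp _ _ (M.acof_of_isIso _).1 hi

lemma ModelStructure.fibrant_iff [HasTerminal C] {X T : C} (hT : IsTerminal T) (p : X ⟶ T) :
    Fibrant M X ↔ M.Fib p := by
  have h : terminal.from X = p ≫ (hT.uniqueUpToIso terminalIsTerminal).hom :=
    terminalIsTerminal.hom_ext _ _
  have h' : p = terminal.from X ≫ (hT.uniqueUpToIso terminalIsTerminal).inv := hT.hom_ext _ _
  refine ⟨fun hX ↦ ?_, fun hp ↦ ?_⟩
  · rw [h']
    exact M.Fib_comp _ _ hX (M.fib_of_isIso _)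
  · rw [Fibrant, h]
    exact M.Fib_comp _ _ hp (M.fib_of_isIso _)

lemma ModelStructure.cofibrant_op_iff [HasTerminal C] [HasInitial Cᵒᵖ] (X : C) :
    Cofibrant M.op (Opposite.op X) ↔ Fibrant M X :=
  M.op.cofibrant_iff (initialOpOfTerminal terminalIsTerminal) (terminal.from X).op

lemma ModelStructure.fibrant_op_iff [HasInitial C] [HasTerminal Cᵒᵖ] (X : C) :
    Fibrant M.op (Opposite.op X) ↔ Cofibrant M X :=
  M.op.fibrant_iff (terminalOpOfInitial initialIsInitial) (initial.to X).op

variable {M}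

lemma Cofibrant.of_cof [HasInitial C] {X Y : C} (hX : Cofibrant M X) (f : X ⟶ Y) (hf : M.Cof f) :
    Cofibrant M Y :=
  (M.cofibrant_iff initialIsInitial (initial.to X ≫ f)).2 (M.Cof_comp _ _ hX hf)

lemma Fibrant.of_fib [HasTerminal C] {X Y : C} (hY : Fibrant M Y) (f : X ⟶ Y) (hf : M.Fib f) :
    Fibrant M X :=
  (M.fibrant_iff terminalIsTerminal (f ≫ terminal.from Y)).2 (M.Fib_comp _ _ hf hY)

end

end

section

open HomotopicalAlgebra MonoidalCategory CartesianMonoidalCategory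

section

variable {C D : Type u} [Category.{v} C] [Category.{v} D]
  {MC : ModelStructure C} {MD : ModelStructure D}

/-- The category of zigzags `x ⟵ a ⇝ b ⟵ y` in the collage of a Quillen adjunction, without
conditions on the objects or on the maps. -/
abbrev Zig (Q : QuillenAdjunction MC MD) (x : C) (y : D) : Type max u v :=
  Comma (Over.forget x ⋙ Q.F) (Under.forget y)

namespace Zig

variable {Q : QuillenAdjunction MC MD} {x : C} {y : D}

/-- The left middle object. -/
abbrev a (X : Zig Q x y) : C := X.left.left

/-- The right middle object. -/
abbrev b (X : Zig Q x y) : D := X.right.right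

/-- The left map. -/
abbrev f (X : Zig Q x y) : X.a ⟶ x := X.left.hom

/-- The bridge map. -/
abbrev g (X : Zig Q x y) : Q.F.obj X.a ⟶ X.b := X.hom

/-- The right map. -/
abbrev h (X : Zig Q x y) : y ⟶ X.b := X.right.hom

/-- Constructor for zigzags. -/
abbrev mk {a : C} {b : D} (f : a ⟶ x) (g : Q.F.obj a ⟶ b) (h : y ⟶ b) : Zig Q x y :=
  { left := Over.mk f, right := Under.mk h, hom := g }

variable {X Y Z : Zig Q x y}

/-- The left component of a morphism. -/
abbrev u (φ : X ⟶ Y) : X.a ⟶ Y.a := φ.left.left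

/-- The right component of a morphism. -/
abbrev v (φ : X ⟶ Y) : X.b ⟶ Y.b := φ.right.right

lemma comm_f (φ : X ⟶ Y) : u φ ≫ Y.f = X.f := Over.w φ.left

lemma comm_g (φ : X ⟶ Y) : Q.F.map (u φ) ≫ Y.g = X.g ≫ v φ := φ.w

lemma comm_h (φ : X ⟶ Y) : X.h ≫ v φ = Y.h := Under.w φ.right

lemma hom_ext {φ ψ : X ⟶ Y} (hu : u φ = u ψ) (hv : v φ = v ψ) : φ = ψ := by
  apply Comma.hom_ext
  · exact Over.OverMorphism.ext hu
  · exact Under.UnderMorphism.ext hv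

/-- Constructor for morphisms of zigzags. -/
def homMk (u : X.a ⟶ Y.a) (v : X.b ⟶ Y.b) (hf : u ≫ Y.f = X.f)
    (hg : Q.F.map u ≫ Y.g = X.g ≫ v) (hh : X.h ≫ v = Y.h) : X ⟶ Y where
  left := Over.homMk u hf
  right := Under.homMk v hh
  w := hg

variable (Q x y) in
/-- The fibrations of zigzags. -/
def fibrations : MorphismProperty (Zig Q x y) := fun _ _ φ ↦ MC.Fib (u φ) ∧ MD.Fib (v φ)

instance [HasFiniteColimits C] [HasFiniteColimits D] : HasFiniteColimits (Zig Q x y) :=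
  have : PreservesColimitsOfSize.{0, 0} Q.F := Q.adj.leftAdjoint_preservesColimits
  have : PreservesFiniteColimits (Over.forget x ⋙ Q.F) := comp_preservesFiniteColimits _ _
  Comma.hasFiniteColimits

lemma exists_fac [HasFiniteColimits D] (φ : X ⟶ Y) :
    ∃ (Z : Zig Q x y) (i : X ⟶ Z) (p : Z ⟶ Y), (fibrations Q x y).llp i ∧
      (MC.Cof (u i) ∧ MC.W (u i)) ∧ (MD.Cof (v i) ∧ MD.W (v i)) ∧
      fibrations Q x y p ∧ i ≫ p = φ := by
  obtain ⟨a, i, p, hi, hi', hp, fac⟩ := MC.fact_acof_fib (u φ)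
  have w : Q.F.map i ≫ Q.F.map p ≫ Y.g = X.g ≫ v φ := by
    rw [← Category.assoc, ← CategoryTheory.Functor.map_comp, fac, comm_g]
  obtain ⟨b, j, q, hj, hj', hq, fac'⟩ := MD.fact_acof_fib
    (pushout.desc (f := Q.F.map i) (g := X.g) (Q.F.map p ≫ Y.g) (v φ) w)
  have hinr : MD.Fib.llp (pushout.inr (Q.F.map i) X.g) :=
    MorphismProperty.of_isPushout (P := MD.Fib.llp) (IsPushout.of_hasPushout _ _).flip
      ((MD.llp_fib_iff _).2 ⟨Q.F_cof i hi, Q.F_acof i hi hi'⟩)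
  rw [MD.llp_fib_iff] at hinr
  have hq₁ : (pushout.inl (Q.F.map i) X.g ≫ j) ≫ q = Q.F.map p ≫ Y.g := by
    rw [Category.assoc, fac', pushout.inl_desc]
  have hq₂ : (pushout.inr (Q.F.map i) X.g ≫ j) ≫ q = v φ := by
    rw [Category.assoc, fac', pushout.inr_desc]
  let Z : Zig Q x y := mk (p ≫ Y.f) (pushout.inl (Q.F.map i) X.g ≫ j)
    (X.h ≫ pushout.inr (Q.F.map i) X.g ≫ j)
  let ι : X ⟶ Z := homMk (Y := Z) i (pushout.inr (Q.F.map i) X.g ≫ j)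
    ((Category.assoc _ _ _).symm.trans ((congrArg (· ≫ Y.f) fac).trans (comm_f φ)))
    (by rw [← Category.assoc, ← Category.assoc, ← pushout.condition]) rfl
  let π : Z ⟶ Y := homMk (X := Z) p q rfl hq₁.symm
    ((Category.assoc _ _ _).trans ((congrArg (X.h ≫ ·) hq₂).trans (comm_h φ)))
  refine ⟨Z, ι, π, fun E E' ψ hψ ↦ ⟨fun {s t} sq ↦ ?_⟩, ⟨hi, hi'⟩,
    ⟨MD.Cof_comp _ _ hinr.1 hj, MD.W_comp _ _ hinr.2 hj'⟩, ⟨hp, hq⟩, hom_ext fac hq₂⟩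
  have sq₁ : CommSq (u s) i (u ψ) (u t) := ⟨congrArg u sq.w⟩
  have := MC.lifting_acof_fib i (u ψ) hi hi' hψ.1
  have w₂ : Q.F.map i ≫ Q.F.map sq₁.lift ≫ E.g = X.g ≫ v s := by
    rw [← Category.assoc, ← CategoryTheory.Functor.map_comp, sq₁.fac_left, comm_g]
  have sq₂ : CommSq (pushout.desc (f := Q.F.map i) (g := X.g) (Q.F.map sq₁.lift ≫ E.g) (v s) w₂)
      j (v ψ) (v t) := ⟨by
    apply pushout.hom_ext
    · rw [pushout.inl_desc_assoc, Category.assoc, ← comm_g ψ, ← Category.assoc,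
        ← CategoryTheory.Functor.map_comp, sq₁.fac_right, comm_g t]
      exact Category.assoc _ _ _
    · rw [pushout.inr_desc_assoc]
      exact (congrArg v sq.w).trans (Category.assoc _ _ _)⟩
  have := MD.lifting_acof_fib j (v ψ) hj hj' hψ.2
  have h₁ : (pushout.inl (Q.F.map i) X.g ≫ j) ≫ sq₂.lift = Q.F.map sq₁.lift ≫ E.g := by
    rw [Category.assoc, sq₂.fac_left, pushout.inl_desc]
  have h₂ : (pushout.inr (Q.F.map i) X.g ≫ j) ≫ sq₂.lift = v s := by
    rw [Category.assoc, sq₂.fac_left, pushout.inr_desc]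
  exact ⟨⟨{
    l := homMk (X := Z) (Y := E) sq₁.lift sq₂.lift
      ((congrArg (sq₁.lift ≫ ·) (comm_f ψ).symm).trans ((Category.assoc _ _ _).symm.trans
        ((congrArg (· ≫ E'.f) sq₁.fac_right).trans (comm_f t))))
      h₁.symm
      ((Category.assoc _ _ _).trans ((congrArg (X.h ≫ ·) h₂).trans (comm_h s)))
    fac_left := hom_ext sq₁.fac_left h₂
    fac_right := hom_ext sq₁.fac_right sq₂.fac_right }⟩⟩

lemma acof_of_llp [HasFiniteColimits D] {φ : X ⟶ Y} (hφ : (fibrations Q x y).llp φ) :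
    (MC.Cof (u φ) ∧ MC.W (u φ)) ∧ (MD.Cof (v φ) ∧ MD.W (v φ)) := by
  obtain ⟨Z, i, p, -, hu, hv, hp, fac⟩ := exists_fac φ
  have := hφ p hp
  obtain ⟨i', r, j, s, h₁, h₂, h₃, h₄⟩ := ModelStructure.isRetractOf_of_lift fac
  have hu' : IsRetractOf (u φ) (u i) :=
    ⟨u i', u r, u j, u s, congrArg u h₁, congrArg u h₂, congrArg u h₃, congrArg u h₄⟩
  have hv' : IsRetractOf (v φ) (v i) :=
    ⟨v i', v r, v j, v s, congrArg v h₁, congrArg v h₂, congrArg v h₃, congrArg v h₄⟩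
  exact ⟨⟨MC.Cof_retract hu' hu.1, MC.W_retract hu' hu.2⟩,
    MD.Cof_retract hv' hv.1, MD.W_retract hv' hv.2⟩

end Zig

end

end

section

open HomotopicalAlgebra MonoidalCategory CartesianMonoidalCategory

section

set_option linter.unusedSectionVars false

variable {C D : Type u} [Category.{v} C] [Category.{v} D]
  {MC : ModelStructure C} {MD : ModelStructure D}
  [HasFiniteLimits C] [HasFiniteColimits C] [HasFiniteLimits D] [HasFiniteColimits D]
  (Q : QuillenAdjunction MC MD) (x : C) (y : D) (S : ∀ ⦃b : D⦄, (y ⟶ b) → Prop)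

namespace Zig

/-- The zigzags with a cofibrant left middle object, whose left map is a weak equivalence,
and whose right map satisfies a given property. -/
def cofibrantZigzags : ObjectProperty (Zig Q x y) := fun X ↦
  Cofibrant MC X.a ∧ MC.W X.f ∧ S X.h

/-- The zigzags with a cofibrant left middle object and a fibrant right middle object, whose left
map is a weak equivalence, and whose right map satisfies a given property. -/
def bifibrantZigzags : ObjectProperty (Zig Q x y) := fun X ↦
  Cofibrant MC X.a ∧ Fibrant MD X.b ∧ MC.W X.f ∧ S X.h

/-- The zigzags with a cofibrant left middle object and a fibrant right middle object, whose left
map is an acyclic fibration, and whose right map satisfies a given property. -/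
def fibrantZigzags : ObjectProperty (Zig Q x y) := fun X ↦
  Cofibrant MC X.a ∧ Fibrant MD X.b ∧ (MC.W X.f ∧ MC.Fib X.f) ∧ S X.h

variable {Q x y S}

instance {X Y : Zig Q x y} (φ : X ⟶ Y) [IsIso φ] : IsIso (u φ) :=
  inferInstanceAs (IsIso ((Comma.fst _ _ ⋙ Over.forget x).map φ))

instance {X Y : Zig Q x y} (φ : X ⟶ Y) [IsIso φ] : IsIso (v φ) :=
  inferInstanceAs (IsIso ((Comma.snd _ _ ⋙ Under.forget y).map φ))

lemma w_f_of_iso {X Y : Zig Q x y} (e : X ≅ Y) (h : MC.W X.f) : MC.W Y.f := by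
  rw [← comm_f e.inv]
  exact MC.W_comp _ _ (MC.acof_of_isIso _).2 h

variable (hS : ∀ ⦃b b' : D⦄ (h : y ⟶ b) (v : b ⟶ b'), S h → MD.Cof v → MD.W v → S (h ≫ v))

include hS

lemma s_h_of_iso {X Y : Zig Q x y} (e : X ≅ Y) (h : S X.h) : S Y.h := by
  rw [← comm_h e.hom]
  exact hS _ _ h (MD.acof_of_isIso _).1 (MD.acof_of_isIso _).2

lemma isClosedUnderIsomorphisms_bifibrantZigzags :
    (bifibrantZigzags Q x y S).IsClosedUnderIsomorphisms where
  of_iso e h := ⟨h.1.of_cof (u e.hom) (MC.acof_of_isIso _).1,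
    h.2.1.of_fib (v e.inv) (MD.fib_of_isIso _), w_f_of_iso e h.2.2.1, s_h_of_iso hS e h.2.2.2⟩

lemma isClosedUnderIsomorphisms_fibrantZigzags :
    (fibrantZigzags Q x y S).IsClosedUnderIsomorphisms where
  of_iso e h := ⟨h.1.of_cof (u e.hom) (MC.acof_of_isIso _).1,
    h.2.1.of_fib (v e.inv) (MD.fib_of_isIso _), ⟨w_f_of_iso e h.2.2.1.1, by
      rw [← comm_f e.inv]
      exact MC.Fib_comp _ _ (MC.fib_of_isIso _) h.2.2.1.2⟩, s_h_of_iso hS e h.2.2.2⟩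

lemma cofibrantZigzags_of_acof {X Y : Zig Q x y} (φ : X ⟶ Y) (hu : MC.Cof (u φ) ∧ MC.W (u φ))
    (hv : MD.Cof (v φ) ∧ MD.W (v φ)) (hX : cofibrantZigzags Q x y S X) :
    cofibrantZigzags Q x y S Y :=
  ⟨hX.1.of_cof _ hu.1, MC.W_of_precomp (u φ) _ hu.2 (by rw [comm_f]; exact hX.2.1), by
    rw [← comm_h φ]
    exact hS _ _ hX.2.2 hv.1 hv.2⟩

lemma exists_fibrantZigzags {X : Zig Q x y} (hX : cofibrantZigzags Q x y S X) :
    ∃ (Y : Zig Q x y) (φ : X ⟶ Y), (fibrations Q x y).llp φ ∧ fibrantZigzags Q x y S Y := by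
  let T : Zig Q x y := mk (𝟙 x) (terminal.from (Q.F.obj x)) (terminal.from y)
  let τ : X ⟶ T := homMk (Y := T) X.f (terminal.from X.b) (Category.comp_id _)
    (terminalIsTerminal.hom_ext _ _) (terminalIsTerminal.hom_ext _ _)
  obtain ⟨Y, i, p, hi, hu, hv, hp, -⟩ := exists_fac τ
  have hY := cofibrantZigzags_of_acof hS i hu hv hX
  refine ⟨Y, i, hi, hY.1, (MD.fibrant_iff terminalIsTerminal (v p)).2 hp.2, ⟨hY.2.1, ?_⟩, hY.2.2⟩
  have h : u p = Y.f := (Category.comp_id _).symm.trans (comm_f p)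
  rw [← h]
  exact hp.1

omit hS in
lemma fibrantZigzags_le : fibrantZigzags Q x y S ≤ bifibrantZigzags Q x y S :=
  fun _ h ↦ ⟨h.1, h.2.1, h.2.2.1.1, h.2.2.2⟩

omit hS in
lemma bifibrantZigzags_le : bifibrantZigzags Q x y S ≤ cofibrantZigzags Q x y S :=
  fun _ h ↦ ⟨h.1, h.2.2.1, h.2.2.2⟩

lemma isWeakHomotopyEquiv_fibrantZigzags :
    IsWeakHomotopyEquiv (nerveMap
      (ObjectProperty.ιOfLE (fibrantZigzags_le (Q := Q) (x := x) (y := y) (S := S)))) := by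
  have := isClosedUnderIsomorphisms_fibrantZigzags (Q := Q) (x := x) hS
  have := isClosedUnderIsomorphisms_bifibrantZigzags (Q := Q) (x := x) hS
  have hV ⦃X Y : Zig Q x y⦄ (φ : X ⟶ Y) (hφ : (fibrations Q x y).llp φ)
      (hX : cofibrantZigzags Q x y S X) : cofibrantZigzags Q x y S Y :=
    cofibrantZigzags_of_acof hS φ (acof_of_llp hφ).1 (acof_of_llp hφ).2 hX
  have h₁ := isWeakHomotopyEquiv_ιOfLE (fibrations Q x y) (cofibrantZigzags Q x y S)
    (bifibrantZigzags Q x y S) bifibrantZigzags_le hV fun X hX ↦ by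
      obtain ⟨Y, φ, hφ, hY⟩ := exists_fibrantZigzags hS hX
      exact ⟨Y, φ, hφ, fibrantZigzags_le _ hY⟩
  have h₂ := isWeakHomotopyEquiv_ιOfLE (fibrations Q x y) (cofibrantZigzags Q x y S)
    (fibrantZigzags Q x y S) (fibrantZigzags_le.trans bifibrantZigzags_le) hV fun X hX ↦
      exists_fibrantZigzags hS hX
  exact .of_comp_right h₁ h₂

end Zig

end

end

section

open HomotopicalAlgebra MonoidalCategory CartesianMonoidalCategory

section

set_option linter.unusedSectionVars false

lemma IsWeakHomotopyEquiv.of_isEquivalence {A B : Type u} [Category.{v} A] [Category.{v} B]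
    (F : A ⥤ B) [F.IsEquivalence] : IsWeakHomotopyEquiv (nerveMap F) :=
  .of_equivalence F.asEquivalence

lemma IsWeakHomotopyEquiv.of_nerveMap_op {A B : Type u} [Category.{v} A] [Category.{v} B]
    {F : A ⥤ B} (h : IsWeakHomotopyEquiv (nerveMap F.op)) : IsWeakHomotopyEquiv (nerveMap F) := by
  have h₁ : IsWeakHomotopyEquiv (nerveMap (F ⋙ opOp B)) :=
    (IsWeakHomotopyEquiv.of_isEquivalence (opOp A)).comp h.nerveMap_op
  exact .of_comp_right (.of_isEquivalence (opOp B)) h₁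

lemma isEquivalence_lift {A B : Type*} [Category* A] [Category* B] (F : A ⥤ B) [F.Full]
    [F.Faithful] (P : ObjectProperty B) (hF : ∀ X, P (F.obj X))
    (h : ∀ Y, P Y → ∃ X, Nonempty (F.obj X ≅ Y)) : (P.lift F hF).IsEquivalence where
  essSurj := ⟨fun Y ↦ by
    obtain ⟨X, ⟨e⟩⟩ := h Y.obj Y.property
    exact ⟨X, ⟨P.isoMk e⟩⟩⟩

variable {C D : Type u} [Category.{v} C] [Category.{v} D]
  {MC : ModelStructure C} {MD : ModelStructure D}
  [HasFiniteLimits C] [HasFiniteColimits C] [HasFiniteLimits D] [HasFiniteColimits D]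
  (Q : QuillenAdjunction MC MD) (x : C) (y : D)

namespace Zig3Coll

/-- The zigzag underlying an object of `Zig3Coll Q x y`. -/
def toZig : Zig3Coll Q x y ⥤ Zig Q x y where
  obj A := Zig.mk A.f A.g A.h
  map {A B} φ := Zig.homMk (X := Zig.mk A.f A.g A.h) (Y := Zig.mk B.f B.g B.h)
    φ.u φ.v φ.comm_f φ.comm_g φ.comm_h

instance : (toZig Q x y).Full where
  map_surjective {A B} φ :=
    ⟨{ u := Zig.u φ
       v := Zig.v φ
       hu := MC.W_of_postcomp _ B.f B.hf (by
        have : Zig.u φ ≫ B.f = A.f := Zig.comm_f φ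
        exact (congrArg (fun t : A.a ⟶ x ↦ MC.W t) this).mpr A.hf)
       hv := MD.W_of_precomp A.h _ A.hh (by
        have : A.h ≫ Zig.v φ = B.h := Zig.comm_h φ
        exact (congrArg (fun t : y ⟶ B.b ↦ MD.W t) this).mpr B.hh)
       comm_f := Zig.comm_f φ
       comm_g := Zig.comm_g φ
       comm_h := Zig.comm_h φ }, rfl⟩

instance : (toZig Q x y).Faithful where
  map_injective h := Zig3CollHom.ext (congrArg Zig.u h) (congrArg Zig.v h)

variable {Q x y}

theorem isWeakHomotopyEquiv_ιOfLE (S : ∀ ⦃b : D⦄, (y ⟶ b) → Prop)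
    (hS : ∀ ⦃b b' : D⦄ (h : y ⟶ b) (v : b ⟶ b'), S h → MD.Cof v → MD.W v → S (h ≫ v))
    (hSW : ∀ ⦃b : D⦄ (h : y ⟶ b), S h → MD.W h)
    (P P' : ObjectProperty (Zig3Coll Q x y)) (hP : ∀ A, P A ↔ MC.Fib A.f ∧ S A.h)
    (hP' : ∀ A, P' A ↔ S A.h) (hPP' : P ≤ P') :
    IsWeakHomotopyEquiv (nerveMap (ObjectProperty.ιOfLE hPP')) := by
  let F : P.FullSubcategory ⥤ (Zig.fibrantZigzags Q x y S).FullSubcategory :=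
    ObjectProperty.lift _ (P.ι ⋙ toZig Q x y) fun A ↦
      ⟨A.obj.ha, A.obj.hb, ⟨A.obj.hf, ((hP _).1 A.property).1⟩, ((hP _).1 A.property).2⟩
  let F' : P'.FullSubcategory ⥤ (Zig.bifibrantZigzags Q x y S).FullSubcategory :=
    ObjectProperty.lift _ (P'.ι ⋙ toZig Q x y) fun A ↦
      ⟨A.obj.ha, A.obj.hb, A.obj.hf, (hP' _).1 A.property⟩
  have : F.IsEquivalence := isEquivalence_lift _ _ _ fun Y hY ↦
    ⟨⟨{ a := Y.a, b := Y.b, ha := hY.1, hb := hY.2.1, f := Y.f, hf := hY.2.2.1.1,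
        g := Y.g, h := Y.h, hh := hSW _ hY.2.2.2 }, (hP _).2 ⟨hY.2.2.1.2, hY.2.2.2⟩⟩, ⟨Iso.refl _⟩⟩
  have : F'.IsEquivalence := isEquivalence_lift _ _ _ fun Y hY ↦
    ⟨⟨{ a := Y.a, b := Y.b, ha := hY.1, hb := hY.2.1, f := Y.f, hf := hY.2.2.1,
        g := Y.g, h := Y.h, hh := hSW _ hY.2.2.2 }, (hP' _).2 hY.2.2.2⟩, ⟨Iso.refl _⟩⟩
  have h : IsWeakHomotopyEquiv (nerveMap (ObjectProperty.ιOfLE hPP') ≫ nerveMap F') :=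
    (IsWeakHomotopyEquiv.of_isEquivalence F).comp (Zig.isWeakHomotopyEquiv_fibrantZigzags hS)
  exact .of_comp_right (.of_isEquivalence F') h

variable (Q x y)

lemma homEquiv_comm {a a' : C} {b b' : D} {g : Q.F.obj a ⟶ b} {g' : Q.F.obj a' ⟶ b'}
    {u : a ⟶ a'} {v : b ⟶ b'} :
    Q.F.map u ≫ g' = g ≫ v ↔
      Q.adj.homEquiv _ _ g ≫ Q.G.map v = u ≫ Q.adj.homEquiv _ _ g' := by
  rw [← Q.adj.homEquiv_naturality_left, ← Q.adj.homEquiv_naturality_right,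
    (Q.adj.homEquiv _ _).injective.eq_iff, eq_comm]

/-- The comparison with the zigzags in the collage of the opposite Quillen adjunction. -/
def opFunctor : (Zig3Coll Q x y)ᵒᵖ ⥤ Zig3Coll Q.op (.op y) (.op x) where
  obj A :=
    { a := .op A.unop.b
      b := .op A.unop.a
      ha := (MD.cofibrant_op_iff _).2 A.unop.hb
      hb := (MC.fibrant_op_iff _).2 A.unop.ha
      f := A.unop.h.op
      hf := A.unop.hh
      g := (Q.adj.homEquiv _ _ A.unop.g).op
      h := A.unop.f.op
      hh := A.unop.hf }
  map φ :=
    { u := φ.unop.v.op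
      v := φ.unop.u.op
      hu := φ.unop.hv
      hv := φ.unop.hu
      comm_f := congrArg Quiver.Hom.op φ.unop.comm_h
      comm_g := congrArg Quiver.Hom.op ((homEquiv_comm Q).1 φ.unop.comm_g)
      comm_h := congrArg Quiver.Hom.op φ.unop.comm_f }
  map_id _ := rfl
  map_comp _ _ := rfl

instance : (opFunctor Q x y).Faithful where
  map_injective {A B _ _} h := Quiver.Hom.unop_inj (Zig3CollHom.ext
    (congrArg (fun χ : Zig3CollHom ((opFunctor Q x y).obj A) ((opFunctor Q x y).obj B) ↦
      χ.v.unop) h)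
    (congrArg (fun χ : Zig3CollHom ((opFunctor Q x y).obj A) ((opFunctor Q x y).obj B) ↦
      χ.u.unop) h))

instance : (opFunctor Q x y).Full where
  map_surjective {A B} φ :=
    let ψ : B.unop ⟶ A.unop :=
      { u := (Zig3CollHom.v φ).unop
        v := (Zig3CollHom.u φ).unop
        hu := Zig3CollHom.hv φ
        hv := Zig3CollHom.hu φ
        comm_f := congrArg Quiver.Hom.unop (Zig3CollHom.comm_h φ)
        comm_g := (homEquiv_comm Q).2 (congrArg Quiver.Hom.unop (Zig3CollHom.comm_g φ))
        comm_h := congrArg Quiver.Hom.unop (Zig3CollHom.comm_f φ) }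
    ⟨ψ.op, rfl⟩

/-- The object corresponding to a zigzag for the opposite Quillen adjunction. -/
def ofOp (A : Zig3Coll Q.op (.op y) (.op x)) : Zig3Coll Q x y where
  a := A.b.unop
  b := A.a.unop
  ha := (MC.fibrant_op_iff A.b.unop).1 A.hb
  hb := (MD.cofibrant_op_iff A.a.unop).1 A.ha
  f := A.h.unop
  hf := A.hh
  g := (Q.adj.homEquiv _ _).symm A.g.unop
  h := A.f.unop
  hh := A.hf

lemma opFunctor_obj_ofOp (A : Zig3Coll Q.op (.op y) (.op x)) :
    (opFunctor Q x y).obj (.op (ofOp Q x y A)) = A :=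
  congrArg (fun t : A.b.unop ⟶ Q.G.obj A.a.unop ↦
    ({ a := A.a, b := A.b, ha := A.ha, hb := A.hb, f := A.f, hf := A.hf, g := t.op,
       h := A.h, hh := A.hh } : Zig3Coll Q.op (.op y) (.op x)))
    ((Q.adj.homEquiv _ _).apply_symm_apply A.g.unop)

theorem isWeakHomotopyEquiv_ι_cof :
    IsWeakHomotopyEquiv
      (nerveMap (ObjectProperty.ι fun A : Zig3Coll Q x y ↦ MD.Cof A.h)) := by
  apply IsWeakHomotopyEquiv.of_nerveMap_op
  let P : ObjectProperty (Zig3Coll Q x y) := fun A ↦ MD.Cof A.h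
  let R : ObjectProperty (Zig3Coll Q.op (.op y) (.op x)) := fun A ↦ MD.op.Fib A.f
  let R' : ObjectProperty (Zig3Coll Q.op (.op y) (.op x)) := ⊤
  let F : P.FullSubcategoryᵒᵖ ⥤ R.FullSubcategory :=
    R.lift (P.ι.op ⋙ opFunctor Q x y) fun A ↦ A.unop.property
  let F' : (Zig3Coll Q x y)ᵒᵖ ⥤ R'.FullSubcategory :=
    R'.lift (opFunctor Q x y) fun _ ↦ trivial
  have : F.IsEquivalence := isEquivalence_lift _ _ _ fun A hA ↦
    ⟨.op ⟨ofOp Q x y A, hA⟩, ⟨eqToIso (opFunctor_obj_ofOp Q x y A)⟩⟩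
  have : F'.IsEquivalence := isEquivalence_lift _ _ _ fun A hA ↦
    ⟨.op (ofOp Q x y A), ⟨eqToIso (opFunctor_obj_ofOp Q x y A)⟩⟩
  have hR : R ≤ R' := fun _ _ ↦ trivial
  have h₁ : IsWeakHomotopyEquiv (nerveMap (ObjectProperty.ιOfLE hR)) :=
    isWeakHomotopyEquiv_ιOfLE (fun _ h ↦ MC.op.W h) (fun _ _ _ _ h _ hv ↦ MC.op.W_comp _ _ h hv)
      (fun _ _ h ↦ h) R R' (fun A ↦ ⟨fun h ↦ ⟨h, A.hh⟩, fun h ↦ h.1⟩)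
      (fun A ↦ ⟨fun _ ↦ A.hh, fun _ ↦ trivial⟩) hR
  have h₂ : IsWeakHomotopyEquiv (nerveMap P.ι.op ≫ nerveMap F') :=
    (IsWeakHomotopyEquiv.of_isEquivalence F).comp h₁
  exact .of_comp_right (.of_isEquivalence F') h₂

theorem isWeakHomotopyEquiv_ι_fib_cof :
    IsWeakHomotopyEquiv
      (nerveMap (ObjectProperty.ι fun A : Zig3Coll Q x y ↦ MC.Fib A.f ∧ MD.Cof A.h)) := by
  let P : ObjectProperty (Zig3Coll Q x y) := fun A ↦ MC.Fib A.f ∧ MD.Cof A.h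
  let P' : ObjectProperty (Zig3Coll Q x y) := fun A ↦ MD.Cof A.h
  have hP : P ≤ P' := fun _ h ↦ h.2
  have h : IsWeakHomotopyEquiv (nerveMap (ObjectProperty.ιOfLE hP)) :=
    isWeakHomotopyEquiv_ιOfLE (fun _ h ↦ MD.Cof h ∧ MD.W h)
      (fun _ _ _ _ h hv hv' ↦ ⟨MD.Cof_comp _ _ h.1 hv, MD.W_comp _ _ h.2 hv'⟩) (fun _ _ h ↦ h.2)
      P P' (fun A ↦ ⟨fun h ↦ ⟨h.1, h.2, A.hh⟩, fun h ↦ ⟨h.1, h.2.1⟩⟩)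
      (fun A ↦ ⟨fun h ↦ ⟨h, A.hh⟩, fun h ↦ h.1⟩) hP
  exact h.comp (isWeakHomotopyEquiv_ι_cof Q x y)

end Zig3Coll

end

end

/-- for a Quillen adjunction `F : C ⇄ D : G`, a cofibrant `x ∈ C` and a
fibrant `y ∈ D`, the inclusion of the full subcategory `Fun_{**}(3̃,(C^c+D^f))^W`
(zigzags whose left leg is an acyclic fibration of `C` and whose right leg is an acyclic
cofibration of `D`) into `Fun_{**}(3,(C^c+D^f))^W` induces a weak homotopy equivalence
of nerves. -/
theorem statement2 {MC : ModelStructure C} {MD : ModelStructure D}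
    (Q : QuillenAdjunction MC MD) (x : C) (y : D)
    (hx : Cofibrant MC x) (hy : Fibrant MD y) :
    IsWeakHomotopyEquiv (nerveMap (ObjectProperty.ι
      (fun A : Zig3Coll Q x y => MC.Fib A.f ∧ MD.Cof A.h))) :=
  Zig3Coll.isWeakHomotopyEquiv_ι_fib_cof Q x y

end Paper
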